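/- arXiv:2402.13078 — 2 statements merged into one kernel-verified Lean document; each statement's English description precedes it below -/
import Mathlib

section
/- Let Ω ⊆ ℝ^N be open and let C ⊆ Ω be GBV-polar in Ω. Then there exists a nonnegative function u ∈ L^1(Ω) ∩ GBV(Ω) such that C ⊆ {x ∈ Ω : the approximate limit ũ(x) exists and ũ(x) = +∞}. -/
open MeasureTheory Metric Filter Set
open scoped ENNReal Topology symmDiff

noncomputable section

abbrev Euc (N : ℕ) : Type := EuclideanSpace ℝ (Fin N)

variable {N : ℕ}

/-- The divergence of a vector field `φ : ℝ^N → ℝ^N`. -/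
def diverg (φ : Euc N → Euc N) (x : Euc N) : ℝ :=
  ∑ i : Fin N, fderiv ℝ φ x (EuclideanSpace.single i 1) i

/-- The admissible test vector fields for the variation in `Ω`:
`C^1`, compactly supported in `Ω`, with `‖φ‖ ≤ 1`. -/
def TestVF (Ω : Set (Euc N)) : Set (Euc N → Euc N) :=
  {φ | ContDiff ℝ 1 φ ∧ HasCompactSupport φ ∧ tsupport φ ⊆ Ω ∧ ∀ x, ‖φ x‖ ≤ 1}

/-- The total variation `V(u, Ω)`. -/
def variation (u : Euc N → ℝ) (Ω : Set (Euc N)) : ℝ≥0∞ :=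
  ⨆ φ ∈ TestVF Ω, ENNReal.ofReal (∫ x in Ω, u x * diverg φ x)

/-- The perimeter `P(A, Ω)` of `A` in `Ω`. -/
def perimeter (A Ω : Set (Euc N)) : ℝ≥0∞ :=
  ⨆ φ ∈ TestVF Ω, ENNReal.ofReal (∫ x in A, diverg φ x)

/-- `u ∈ BV(Ω)`. -/
def MemBV (u : Euc N → ℝ) (Ω : Set (Euc N)) : Prop :=
  IntegrableOn u Ω volume ∧ variation u Ω < ⊤

/-- `u ∈ BV_loc(Ω)`. -/
def MemBVloc (u : Euc N → ℝ) (Ω : Set (Euc N)) : Prop :=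
  ∀ Ω' : Set (Euc N), IsOpen Ω' → IsCompact (closure Ω') → closure Ω' ⊆ Ω → MemBV u Ω'

/-- `u ∈ GBV(Ω)`: measurable, and every truncation `(-m) ∨ u ∧ m` is in `BV_loc(Ω)`. -/
def MemGBV (u : Euc N → ℝ) (Ω : Set (Euc N)) : Prop :=
  AEMeasurable u (volume.restrict Ω) ∧
    ∀ m : ℝ, 0 < m → MemBVloc (fun x => max (-m) (min (u x) m)) Ω

/-- `A` has locally finite perimeter in `Ω`. -/
def HasLocFinPerimeter (A Ω : Set (Euc N)) : Prop :=
  ∀ Ω' : Set (Euc N), IsOpen Ω' → IsCompact (closure Ω') → closure Ω' ⊆ Ω →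
    perimeter A Ω' < ⊤

/-- `A` has density `t` at `x`. -/
def HasDensity (A : Set (Euc N)) (x : Euc N) (t : ℝ) : Prop :=
  Tendsto (fun ρ : ℝ => volume (A ∩ ball x ρ) / volume (ball x ρ)) (𝓝[>] 0)
    (𝓝 (ENNReal.ofReal t))

/-- The approximate upper limit `u⁺(x)` of `u` at `x` (relative to `Ω`), with `inf ∅ = ⊤`. -/
def approxUpper (u : Euc N → ℝ) (Ω : Set (Euc N)) (x : Euc N) : EReal :=
  sInf {t : EReal | ∃ s : ℝ, t = (s : EReal) ∧ HasDensity {y | y ∈ Ω ∧ s < u y} x 0}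

/-- The approximate lower limit `u⁻(x)` of `u` at `x` (relative to `Ω`), with `sup ∅ = ⊥`. -/
def approxLower (u : Euc N → ℝ) (Ω : Set (Euc N)) (x : Euc N) : EReal :=
  sSup {t : EReal | ∃ s : ℝ, t = (s : EReal) ∧ HasDensity {y | y ∈ Ω ∧ u y < s} x 0}

/-- The approximate limit `ũ(x)` exists (i.e. `u⁺(x) = u⁻(x)`) and is `+∞`. -/
def HasApproxLimitTop (u : Euc N → ℝ) (Ω : Set (Euc N)) (x : Euc N) : Prop :=
  approxUpper u Ω x = ⊤ ∧ approxLower u Ω x = ⊤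

/-- The approximate limit `ũ(x)` exists and `|ũ(x)| = +∞`. -/
def HasInfApproxLimit (u : Euc N → ℝ) (Ω : Set (Euc N)) (x : Euc N) : Prop :=
  (approxUpper u Ω x = ⊤ ∧ approxLower u Ω x = ⊤) ∨
    (approxUpper u Ω x = ⊥ ∧ approxLower u Ω x = ⊥)

/-- `C` is `L⁰`-polar in `Ω`. -/
def L0Polar (C Ω : Set (Euc N)) : Prop :=
  ∃ u : Euc N → ℝ, AEMeasurable u (volume.restrict Ω) ∧
    C ⊆ {x | x ∈ Ω ∧ HasInfApproxLimit u Ω x}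

/-- `C` is `BV`-polar in `Ω`. -/
def BVPolar (C Ω : Set (Euc N)) : Prop :=
  ∃ u : Euc N → ℝ, MemBV u Ω ∧ C ⊆ {x | x ∈ Ω ∧ HasInfApproxLimit u Ω x}

/-- `C` is `GBV`-polar in `Ω`. -/
def GBVPolar (C Ω : Set (Euc N)) : Prop :=
  ∃ u : Euc N → ℝ, MemGBV u Ω ∧ C ⊆ {x | x ∈ Ω ∧ HasInfApproxLimit u Ω x}

/-- The set `A^{(1)}` of points of `Ω` where `A` has density `1`. -/
def densityOne (A Ω : Set (Euc N)) : Set (Euc N) :=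
  {x | x ∈ Ω ∧ HasDensity A x 1}

open scoped Convolution

lemma lem_translate {N : ℕ} (U : Set (Euc N)) (w : Euc N → ℝ)
    (hw : IntegrableOn w U volume) (hV : variation w U < ⊤) (i : Fin N) (h : ℝ) (hh : 0 ≤ h)
    (ψ : Euc N → ℝ) (hψ : ContDiff ℝ 1 ψ) (hc : HasCompactSupport ψ) (hb : ∀ x, |ψ x| ≤ 1)
    (hs : ∀ s ∈ Icc 0 h, ∀ x, x + s • EuclideanSpace.single i (1 : ℝ) ∈ tsupport ψ → x ∈ U) :
    ∫ x in U, w x * (ψ (x + h • EuclideanSpace.single i (1 : ℝ)) - ψ x)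
      ≤ h * (variation w U).toReal := by
  set e : Euc N := EuclideanSpace.single i (1 : ℝ) with he
  have hcont : Continuous (fun x => fderiv ℝ ψ x e) :=
    (hψ.continuous_fderiv (by norm_num)).clm_apply continuous_const
  have hcs : HasCompactSupport (fun x => fderiv ℝ ψ x e) := by
    refine (hc.fderiv (𝕜 := ℝ)).comp_left (g := fun L : Euc N →L[ℝ] ℝ => L e) (by simp)
  obtain ⟨B, hB⟩ := hcont.bounded_above_of_compact_support hcs
  have hderiv : ∀ x s, HasDerivAt (fun s : ℝ => ψ (x + s • e)) (fderiv ℝ ψ (x + s • e) e) s := by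
    intro x s
    have h1 : HasFDerivAt ψ (fderiv ℝ ψ (x + s • e)) (x + s • e) :=
      (hψ.differentiable (by norm_num) _).hasFDerivAt
    have h2 : HasDerivAt (fun s : ℝ => x + s • e) e s := by
      simpa using ((hasDerivAt_id s).smul_const e).const_add x
    exact h1.comp_hasDerivAt s h2
  have hftc : ∀ x, ψ (x + h • e) - ψ x = ∫ s in (0:ℝ)..h, fderiv ℝ ψ (x + s • e) e := by
    intro x
    rw [intervalIntegral.integral_eq_sub_of_hasDerivAt (fun s _ => hderiv x s)]
    · simp
    · apply Continuous.intervalIntegrable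
      exact hcont.comp (by fun_prop)
  have hprodI : Integrable (Function.uncurry fun (s : ℝ) (x : Euc N) => w x * fderiv ℝ ψ (x + s • e) e)
      ((volume.restrict (uIoc 0 h)).prod (volume.restrict U)) := by
    have h1 : Integrable (fun p : ℝ × Euc N => w p.2)
        ((volume.restrict (uIoc 0 h)).prod (volume.restrict U)) := by
      have : IsFiniteMeasure ((volume : Measure ℝ).restrict (uIoc 0 h)) := by
        rw [uIoc_of_le hh]; infer_instance
      exact Integrable.comp_snd hw _
    refine h1.mul_bdd (c := B) ?_ ?_
    · apply Continuous.aestronglyMeasurable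
      exact hcont.comp (by fun_prop)
    · exact Eventually.of_forall fun p => hB _
  have hswap := intervalIntegral_integral_swap hprodI
  have hkey : ∀ s ∈ Icc 0 h, ∫ x in U, w x * fderiv ℝ ψ (x + s • e) e ≤ (variation w U).toReal := by
    intro s hsI
    let φ : Euc N → Euc N := fun x => ψ (x + s • e) • e
    have hφ1 : ContDiff ℝ 1 φ := by
      have : ContDiff ℝ 1 (fun x : Euc N => x + s • e) := by fun_prop
      exact (hψ.comp this).smul contDiff_const
    have hts : tsupport φ ⊆ (fun x => x + s • e) ⁻¹' tsupport ψ := by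
      apply closure_minimal
      · intro x hx
        apply subset_tsupport
        intro h0
        apply hx
        simp [φ, h0]
      · exact (isClosed_tsupport ψ).preimage (by fun_prop)
    have hφ : φ ∈ TestVF U := by
      refine ⟨hφ1, ?_, ?_, ?_⟩
      · have h2 : HasCompactSupport (fun x => ψ (x + s • e)) :=
          hc.comp_homeomorph (Homeomorph.addRight (s • e))
        exact h2.smul_right
      · exact fun x hx => hs s hsI x (hts hx)
      · intro x
        simp only [φ, norm_smul, he, Real.norm_eq_abs]
        simpa using hb _
    have hdiv : ∀ x, diverg φ x = fderiv ℝ ψ (x + s • e) e := by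
      intro x
      have h1 : HasFDerivAt ψ (fderiv ℝ ψ (x + s • e)) (x + s • e) :=
        (hψ.differentiable (by norm_num) _).hasFDerivAt
      have h2 : HasFDerivAt (fun x : Euc N => x + s • e) (ContinuousLinearMap.id ℝ _) x :=
        (hasFDerivAt_id x).add_const _
      have h3 := (h1.comp x h2).smul_const e
      have h4 : fderiv ℝ φ x = _ := h3.fderiv
      unfold diverg
      rw [h4]
      rw [Finset.sum_eq_single i]
      · simp [he]
      · intro j _ hj
        simp [he, hj]
      · simp
    have hle : ENNReal.ofReal (∫ x in U, w x * diverg φ x) ≤ variation w U :=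
      le_iSup₂ (f := fun φ (_ : φ ∈ TestVF U) => ENNReal.ofReal (∫ x in U, w x * diverg φ x)) φ hφ
    have := (ENNReal.ofReal_le_iff_le_toReal hV.ne).1 hle
    simpa only [hdiv] using this
  calc ∫ x in U, w x * (ψ (x + h • e) - ψ x)
      = ∫ x in U, ∫ s in (0:ℝ)..h, w x * fderiv ℝ ψ (x + s • e) e := by
        simp only [hftc, intervalIntegral.integral_const_mul]
    _ = ∫ s in (0:ℝ)..h, ∫ x in U, w x * fderiv ℝ ψ (x + s • e) e := hswap.symm
    _ ≤ ∫ s in (0:ℝ)..h, (variation w U).toReal := by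
        apply intervalIntegral.integral_mono_on hh
        · have := hprodI.integral_prod_left
          rw [intervalIntegrable_iff]
          exact this
        · simp
        · exact hkey
    _ = h * (variation w U).toReal := by simp

lemma lem_L1 {N : ℕ} (K : Set (Euc N)) (hK : IsCompact K) (δ : ℝ) (hδ : 0 < δ) (w : Euc N → ℝ)
    (hw : IntegrableOn w (thickening δ K) volume) (hV : variation w (thickening δ K) < ⊤)
    (i : Fin N) (h : ℝ) (hh : 0 ≤ h) (hhδ : h < δ / 2) :
    ∫ x in K, |(thickening δ K).indicator w (x - h • EuclideanSpace.single i (1 : ℝ))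
        - (thickening δ K).indicator w x| ≤ h * (variation w (thickening δ K)).toReal := by
  set e : Euc N := EuclideanSpace.single i (1 : ℝ) with he
  have hne : ‖e‖ = 1 := by simp [he]
  set U := thickening δ K with hU
  have hUo : IsOpen U := isOpen_thickening
  set W := U.indicator w with hW
  have hWi : Integrable W volume := hw.integrable_indicator hUo.measurableSet
  set g : Euc N → ℝ := fun x => W (x - h • e) - W x with hg
  have hgi : Integrable g volume := (hWi.comp_sub_right (h • e)).sub hWi
  set s : Euc N → ℝ := K.indicator (fun x => SignType.sign (g x)) with hs
  have hs1 : ∀ x, |s x| ≤ 1 := by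
    intro x
    simp only [hs, indicator]
    split_ifs
    · rcases lt_trichotomy (g x) 0 with h | h | h <;> simp [h]
    · simp
  have hsm : AEStronglyMeasurable s volume := by
    apply AEStronglyMeasurable.indicator _ hK.measurableSet
    have hm : Measurable (fun y : ℝ => ((SignType.sign y : SignType) : ℝ)) := by
      have : (fun y : ℝ => ((SignType.sign y : SignType) : ℝ)) =
          fun y => if 0 < y then 1 else if y < 0 then -1 else 0 := by
        funext y
        simp only [sign_apply]
        split_ifs <;> simp
      rw [this]
      exact Measurable.ite measurableSet_Ioi measurable_const
        (Measurable.ite measurableSet_Iio measurable_const measurable_const)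
    exact (hm.comp_aemeasurable hgi.aestronglyMeasurable.aemeasurable).aestronglyMeasurable
  have hsi : Integrable s volume := by
    have h1 : Integrable (K.indicator (fun _ => (1:ℝ))) volume :=
      (integrable_indicator_iff hK.measurableSet).2 (integrableOn_const hK.measure_lt_top.ne)
    refine h1.mono hsm (Eventually.of_forall fun x => ?_)
    by_cases hx : x ∈ K
    · simpa [hx] using hs1 x
    · simp [hs, hx]
  let ρ : ℕ → ContDiffBump (0 : Euc N) := fun n =>
    ⟨δ / 8 / (n + 1), δ / 4 / (n + 1), by positivity, by gcongr; norm_num⟩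
  let ψ : ℕ → Euc N → ℝ := fun n =>
    ((ρ n).normed volume ⋆[ContinuousLinearMap.lsmul ℝ ℝ, volume] s)
  have hρ : ∀ n, (ρ n).rOut ≤ δ / 4 := by
    intro n
    change δ / 4 / (n + 1) ≤ δ / 4
    apply div_le_self (by positivity)
    have : (0:ℝ) ≤ n := Nat.cast_nonneg n
    linarith
  have hlim : ∀ᵐ x, Tendsto (fun n => ψ n x) atTop (𝓝 (s x)) := by
    apply ContDiffBump.ae_convolution_tendsto_right_of_locallyIntegrable (K := 2)
    · change Tendsto (fun n : ℕ => δ / 4 / ((n:ℝ) + 1)) atTop (𝓝 0)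
      apply Tendsto.div_atTop tendsto_const_nhds
      exact tendsto_atTop_add_const_right _ _ tendsto_natCast_atTop_atTop
    · refine Eventually.of_forall fun n => ?_
      change δ / 4 / ((n:ℝ) + 1) ≤ 2 * (δ / 8 / ((n:ℝ) + 1))
      apply le_of_eq; ring
    · exact hsi.locallyIntegrable
  have hψ1 : ∀ n, ContDiff ℝ 1 (ψ n) := by
    intro n
    exact (ρ n).hasCompactSupport_normed.contDiff_convolution_left (n := 1) _ (ρ n).contDiff_normed
      hsi.locallyIntegrable
  have hψb : ∀ n x, |ψ n x| ≤ 1 := by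
    intro n x
    have := dist_convolution_le (μ := volume) (z₀ := (0:ℝ)) (x₀ := x) (g := s) zero_le_one
      (ρ n).support_normed_eq.subset (ρ n).nonneg_normed ((ρ n).integral_normed (μ := volume)) hsm
      (fun y _ => by simpa using hs1 y)
    simpa using this
  have hψ0 : ∀ n x, x ∉ cthickening (δ / 4) K → ψ n x = 0 := by
    intro n x hx
    have := dist_convolution_le (μ := volume) (z₀ := (0:ℝ)) (x₀ := x) (g := s) le_rfl
      (ρ n).support_normed_eq.subset (ρ n).nonneg_normed ((ρ n).integral_normed (μ := volume)) hsm
      (fun y hy => by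
        have : y ∉ K := by
          intro hyK
          apply hx
          refine mem_cthickening_of_dist_le x y _ _ hyK ?_
          rw [dist_comm]
          exact (le_of_lt hy).trans (hρ n)
        simp [hs, this])
    simpa using this
  have hψt : ∀ n, tsupport (ψ n) ⊆ cthickening (δ / 4) K := by
    intro n
    apply closure_minimal _ isClosed_cthickening
    intro x hx
    by_contra hx'
    exact hx (hψ0 n x hx')
  have hψc : ∀ n, HasCompactSupport (ψ n) := fun n =>
    hK.cthickening.of_isClosed_subset (isClosed_tsupport _) (hψt n)
  have hbound : ∀ n, ∫ x, g x * ψ n x ≤ h * (variation w U).toReal := by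
    intro n
    have h1 := lem_translate U w hw hV i h hh (ψ n) (hψ1 n) (hψc n) (hψb n) (by
      intro t ht x hx
      have h2 : x + t • e ∈ thickening (δ / 2) K :=
        cthickening_subset_thickening' (by positivity) (by linarith) K (hψt n hx)
      rw [mem_thickening_iff] at h2 ⊢
      obtain ⟨z, hz, hd⟩ := h2
      refine ⟨z, hz, ?_⟩
      have h3 : dist x (x + t • e) ≤ h := by
        simp [dist_eq_norm, norm_smul, hne, abs_of_nonneg ht.1, ht.2]
      linarith [dist_triangle x (x + t • e) z])
    have hi1 : Integrable (fun x => W (x - h • e) * ψ n x) volume :=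
      (hWi.comp_sub_right (h • e)).mul_bdd (c := 1) (hψ1 n).continuous.aestronglyMeasurable
        (Eventually.of_forall fun x => hψb n x)
    have hi2 : Integrable (fun x => W x * ψ n x) volume :=
      hWi.mul_bdd (c := 1) (hψ1 n).continuous.aestronglyMeasurable
        (Eventually.of_forall fun x => hψb n x)
    have hi3 : Integrable (fun x => W x * ψ n (x + h • e)) volume := by
      refine hWi.mul_bdd (c := 1) ?_ (Eventually.of_forall fun x => hψb n _)
      exact ((hψ1 n).continuous.comp (by fun_prop)).aestronglyMeasurable
    have h4 : ∫ x, W (x - h • e) * ψ n x = ∫ x, W x * ψ n (x + h • e) := by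
      rw [← integral_add_right_eq_self _ (h • e)]
      simp
    calc ∫ x, g x * ψ n x = ∫ x, (W (x - h • e) * ψ n x - W x * ψ n x) := by
          simp only [hg, sub_mul]
      _ = ∫ x, (W x * ψ n (x + h • e) - W x * ψ n x) := by
          rw [integral_sub hi1 hi2, integral_sub hi3 hi2, h4]
      _ = ∫ x in U, w x * (ψ n (x + h • e) - ψ n x) := by
          rw [← integral_indicator hUo.measurableSet]
          congr 1
          funext x
          by_cases hx : x ∈ U <;> simp [hW, hx, mul_sub]
      _ ≤ _ := h1
  have hconv : Tendsto (fun n => ∫ x, g x * ψ n x) atTop (𝓝 (∫ x, g x * s x)) := by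
    apply tendsto_integral_of_dominated_convergence (fun x => |g x|)
    · intro n
      exact hgi.aestronglyMeasurable.mul (hψ1 n).continuous.aestronglyMeasurable
    · exact hgi.abs
    · intro n
      refine Eventually.of_forall fun x => ?_
      rw [Real.norm_eq_abs, abs_mul]
      exact mul_le_of_le_one_right (abs_nonneg _) (hψb n x)
    · filter_upwards [hlim] with x hx
      exact hx.const_mul _
  have hfin : ∫ x, g x * s x = ∫ x in K, |g x| := by
    rw [← integral_indicator hK.measurableSet]
    congr 1
    funext x
    by_cases hx : x ∈ K
    · simp [hs, hx]
    · simp [hs, hx]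
  rw [← hfin]
  exact le_of_tendsto' hconv hbound

lemma lem_comp {N : ℕ} (O K : Set (Euc N)) (hO : IsOpen O) (hK : IsCompact K) (hOK : O ⊆ K)
    (δ : ℝ) (hδ : 0 < δ) (w z : Euc N → ℝ)
    (hw : IntegrableOn w (thickening δ K) volume) (hV : variation w (thickening δ K) < ⊤)
    (hz : IntegrableOn z (thickening δ K) volume)
    (hzw : ∀ x ∈ thickening δ K, ∀ y ∈ thickening δ K, |z x - z y| ≤ ‖x - y‖ + |w x - w y|) :
    variation z O < ⊤ := by
  set U := thickening δ K with hU
  have hUo : IsOpen U := isOpen_thickening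
  have hKU : K ⊆ U := self_subset_thickening hδ K
  set W := U.indicator w with hW
  set Z := U.indicator z with hZ
  have hWi : Integrable W volume := hw.integrable_indicator hUo.measurableSet
  have hZi : Integrable Z volume := hz.integrable_indicator hUo.measurableSet
  set V := (variation w U).toReal with hVdef
  set A : ℝ := volume.real K + V with hA
  have main : ∀ φ ∈ TestVF O, ∫ x in O, z x * diverg φ x ≤ N * A := by
    rintro φ ⟨hφ1, hφc, hφs, hφb⟩
    -- components
    have hcomp : ∀ i : Fin N, ContDiff ℝ 1 (fun x => φ x i) := fun i => by
      have h1 : ContDiff ℝ 1 (fun v : Euc N => v i) :=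
        (EuclideanSpace.proj (𝕜 := ℝ) i).contDiff
      exact h1.comp hφ1
    have hcc : ∀ i : Fin N, HasCompactSupport (fun x => φ x i) := fun i =>
      hφc.comp_left (g := fun v : Euc N => v i) (by simp)
    have hfd : ∀ (i : Fin N) x v, fderiv ℝ (fun x => φ x i) x v = fderiv ℝ φ x v i := by
      intro i x v
      have h1 : HasFDerivAt φ (fderiv ℝ φ x) x := (hφ1.differentiable (by norm_num) x).hasFDerivAt
      have h2 := ((EuclideanSpace.proj i : Euc N →L[ℝ] ℝ).hasFDerivAt (x := φ x)).comp x h1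
      have h3 : fderiv ℝ (fun x => φ x i) x = _ := h2.fderiv
      rw [h3]; rfl
    have hcontd : ∀ i : Fin N, Continuous
        (fun x => fderiv ℝ φ x (EuclideanSpace.single i 1) i) := fun i => by
      simp only [← hfd]
      exact ((hcomp i).continuous_fderiv (by norm_num)).clm_apply continuous_const
    have hcsd : ∀ i : Fin N, HasCompactSupport
        (fun x => fderiv ℝ φ x (EuclideanSpace.single i 1) i) := fun i =>
      (hφc.fderiv (𝕜 := ℝ)).comp_left
        (g := fun L : Euc N →L[ℝ] Euc N => L (EuclideanSpace.single i 1) i) (by simp)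
    have hid : ∀ i : Fin N, Integrable
        (fun x => Z x * fderiv ℝ φ x (EuclideanSpace.single i 1) i) volume := fun i => by
      obtain ⟨B, hB⟩ := (hcontd i).bounded_above_of_compact_support (hcsd i)
      exact hZi.mul_bdd (c := B) (hcontd i).aestronglyMeasurable (Eventually.of_forall hB)
    have hφb' : ∀ i x, |φ x i| ≤ 1 := fun i x =>
      (PiLp.norm_apply_le (φ x) i).trans (hφb x)
    have hφ0 : ∀ x, x ∉ O → φ x = 0 := fun x hx =>
      image_eq_zero_of_notMem_tsupport fun h => hx (hφs h)
    have hstep : ∀ i : Fin N,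
        ∫ x, Z x * fderiv ℝ φ x (EuclideanSpace.single i 1) i ≤ A := by
      intro i
      set e : Euc N := EuclideanSpace.single i (1 : ℝ) with he
      have hne : ‖e‖ = 1 := by simp [he]
      obtain ⟨C, hC⟩ := (hcomp i).lipschitzWith_of_hasCompactSupport (hcc i) (by norm_num)
      have hlim : Tendsto (fun n : ℕ => ∫ x, Z x *
          (((n : ℝ) + 1) * (φ (x + ((n : ℝ) + 1)⁻¹ • e) i - φ x i))) atTop
          (𝓝 (∫ x, Z x * fderiv ℝ φ x e i)) := by
        apply tendsto_integral_of_dominated_convergence (fun x => |Z x| * C)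
        · intro n
          apply hZi.aestronglyMeasurable.mul
          apply Continuous.aestronglyMeasurable
          have h1 := (hcomp i).continuous
          have h2 : Continuous (fun x => φ (x + ((n : ℝ) + 1)⁻¹ • e) i) :=
            h1.comp (by fun_prop)
          exact continuous_const.mul (h2.sub h1)
        · exact hZi.abs.mul_const _
        · intro n
          refine Eventually.of_forall fun x => ?_
          rw [Real.norm_eq_abs, abs_mul]
          gcongr
          have hn : (0:ℝ) < n + 1 := by positivity
          have h1 := hC.dist_le_mul (x + ((n : ℝ) + 1)⁻¹ • e) x
          rw [Real.dist_eq, dist_eq_norm, add_sub_cancel_left, norm_smul, hne, mul_one,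
            Real.norm_eq_abs, abs_of_pos (inv_pos.2 hn)] at h1
          rw [abs_mul, abs_of_pos hn]
          calc ((n:ℝ) + 1) * |φ (x + ((n : ℝ) + 1)⁻¹ • e) i - φ x i|
              ≤ ((n:ℝ) + 1) * (C * ((n:ℝ) + 1)⁻¹) := by gcongr
            _ = C := by field_simp
        · refine Eventually.of_forall fun x => ?_
          apply Tendsto.const_mul
          have h1 : HasFDerivAt (fun x => φ x i) (fderiv ℝ (fun x => φ x i) x) x :=
            ((hcomp i).differentiable (by norm_num) x).hasFDerivAt
          have h2 := (h1.lim_real e).comp (tendsto_atTop_add_const_right atTop (1:ℝ)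
            (tendsto_natCast_atTop_atTop (R := ℝ)))
          rw [hfd] at h2
          exact h2
      refine le_of_tendsto hlim ?_
      have hev : ∀ᶠ n : ℕ in atTop, ((n:ℝ) + 1)⁻¹ < δ / 2 := by
        have : Tendsto (fun n : ℕ => ((n:ℝ) + 1)⁻¹) atTop (𝓝 0) :=
          tendsto_inv_atTop_zero.comp
            (tendsto_atTop_add_const_right _ _ tendsto_natCast_atTop_atTop)
        exact this.eventually_lt_const (by positivity)
      filter_upwards [hev] with n hn
      have hn1 : (0:ℝ) < n + 1 := by positivity
      set h : ℝ := ((n:ℝ) + 1)⁻¹ with hh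
      have hpos : 0 < h := inv_pos.2 hn1
      have hL1 := lem_L1 K hK δ hδ w hw hV i h hpos.le hn
      rw [← hU, ← hW, ← he] at hL1
      have hi1 : Integrable (fun x => Z (x - h • e) * φ x i) volume :=
        (hZi.comp_sub_right (h • e)).mul_bdd (c := 1) (hcomp i).continuous.aestronglyMeasurable
          (Eventually.of_forall fun x => hφb' i x)
      have hi2 : Integrable (fun x => Z x * φ x i) volume :=
        hZi.mul_bdd (c := 1) (hcomp i).continuous.aestronglyMeasurable
          (Eventually.of_forall fun x => hφb' i x)
      have hi3 : Integrable (fun x => Z x * φ (x + h • e) i) volume := by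
        refine hZi.mul_bdd (c := 1) ?_ (Eventually.of_forall fun x => hφb' i _)
        exact ((hcomp i).continuous.comp (f := fun x => x + h • e) (by fun_prop)).aestronglyMeasurable
      have h4 : ∫ x, Z (x - h • e) * φ x i = ∫ x, Z x * φ (x + h • e) i := by
        rw [← integral_add_right_eq_self _ (h • e)]
        simp
      have hdW : Integrable (fun x => |W (x - h • e) - W x|) volume :=
        ((hWi.comp_sub_right (h • e)).sub hWi).abs
      calc ∫ x, Z x * (((n : ℝ) + 1) * (φ (x + h • e) i - φ x i))
          = ((n : ℝ) + 1) * ∫ x, (Z x * φ (x + h • e) i - Z x * φ x i) := by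
            rw [← integral_const_mul]
            congr 1; funext x; ring
        _ = ((n : ℝ) + 1) * ∫ x, (Z (x - h • e) - Z x) * φ x i := by
            congr 1
            rw [integral_sub hi3 hi2, ← h4, ← integral_sub hi1 hi2]
            congr 1; funext x; ring
        _ = ((n : ℝ) + 1) * ∫ x in K, (Z (x - h • e) - Z x) * φ x i := by
            congr 1
            symm
            apply setIntegral_eq_integral_of_forall_compl_eq_zero
            intro x hx
            rw [hφ0 x fun hx' => hx (hOK hx')]
            simp
        _ ≤ ((n : ℝ) + 1) * ∫ x in K, (h + |W (x - h • e) - W x|) := by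
            gcongr ((n : ℝ) + 1) * ?_
            apply setIntegral_mono_on
            · have := hi1.sub hi2
              refine Integrable.integrableOn (this.congr (Eventually.of_forall fun x => ?_))
              simp [sub_mul]
            · exact (integrableOn_const hK.measure_lt_top.ne).add hdW.integrableOn
            · exact hK.measurableSet
            · intro x hx
              have hxU : x ∈ U := hKU hx
              have hyU : x - h • e ∈ U := by
                rw [hU, mem_thickening_iff]
                refine ⟨x, hx, ?_⟩
                simp only [dist_eq_norm, sub_sub_cancel_left, norm_neg, norm_smul, hne, mul_one,
                  Real.norm_eq_abs, abs_of_pos hpos]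
                linarith
              have h5 := hzw _ hyU _ hxU
              have h6 : ‖x - h • e - x‖ = h := by
                simp [norm_smul, hne, abs_of_pos hpos]
              rw [h6] at h5
              simp only [hZ, hW, indicator_of_mem hxU, indicator_of_mem hyU]
              calc _ ≤ |(z (x - h • e) - z x) * φ x i| := le_abs_self _
                _ ≤ |z (x - h • e) - z x| := by
                  rw [abs_mul]
                  exact mul_le_of_le_one_right (abs_nonneg _) (hφb' i x)
                _ ≤ _ := h5
        _ = ((n : ℝ) + 1) * (volume.real K * h + ∫ x in K, |W (x - h • e) - W x|) := by
            have hci : IntegrableOn (fun _ : Euc N => h) K volume :=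
              integrableOn_const hK.measure_lt_top.ne
            rw [integral_add hci hdW.integrableOn]
            simp
        _ ≤ ((n : ℝ) + 1) * (volume.real K * h + h * V) := by gcongr
        _ = A := by rw [hA, hh]; field_simp
    have heq : ∫ x in O, z x * diverg φ x = ∑ i : Fin N,
        ∫ x, Z x * fderiv ℝ φ x (EuclideanSpace.single i 1) i := by
      rw [← integral_finsetSum _ fun i _ => hid i, ← integral_indicator hO.measurableSet]
      congr 1
      funext x
      rw [← Finset.mul_sum]
      by_cases hx : x ∈ O
      · simp [hx, hZ, hKU (hOK hx), diverg]
      · have h0 : fderiv ℝ φ x = 0 := by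
          apply image_eq_zero_of_notMem_tsupport
          intro h
          exact hx (hφs (tsupport_fderiv_subset ℝ h))
        simp [hx, h0]
    rw [heq]
    calc _ ≤ ∑ i : Fin N, A := Finset.sum_le_sum fun i _ => hstep i
      _ = N * A := by simp
  calc variation z O ≤ ENNReal.ofReal (N * A) := by
        apply iSup₂_le
        intro φ hφ
        exact ENNReal.ofReal_le_ofReal (main φ hφ)
    _ < ⊤ := ENNReal.ofReal_lt_top

lemma exists_slow (τ : ℕ → ℝ) : ∃ f : ℝ → ℝ, (∀ a b, |f a - f b| ≤ |a - b|) ∧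
    (∀ R, ∃ T, ∀ t, T ≤ t → R ≤ f t) ∧ (∀ k t, t ≤ τ k → f t ≤ (k : ℝ)) := by
  have hbdd : ∀ t, BddBelow (range fun k : ℕ => (k : ℝ) + max 0 (t - τ k)) := by
    intro t
    refine ⟨0, ?_⟩
    rintro _ ⟨k, rfl⟩
    positivity
  refine ⟨fun t => ⨅ k : ℕ, ((k : ℝ) + max 0 (t - τ k)), ?_, ?_, ?_⟩
  · have key : ∀ a b : ℝ, (⨅ k : ℕ, ((k : ℝ) + max 0 (a - τ k))) - |a - b| ≤
        ⨅ k : ℕ, ((k : ℝ) + max 0 (b - τ k)) := by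
      intro a b
      apply le_ciInf
      intro k
      have h1 := ciInf_le (hbdd a) k
      have h2 : max 0 (a - τ k) ≤ max 0 (b - τ k) + |a - b| := by
        apply max_le
        · positivity
        · linarith [le_abs_self (a - b), le_max_right 0 (b - τ k)]
      linarith
    intro a b
    have h1 := key a b
    have h2 := key b a
    rw [abs_sub_comm b a] at h2
    rw [abs_le]
    constructor <;> linarith
  · intro R
    obtain ⟨n, hn⟩ := exists_nat_ge R
    obtain ⟨B, hB⟩ : ∃ B, ∀ k < n, τ k ≤ B := by
      obtain ⟨B, hB⟩ := ((Finset.range n).image τ).bddAbove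
      exact ⟨B, fun k hk => hB (by simpa using ⟨k, hk, rfl⟩)⟩
    refine ⟨B + R, fun t ht => ?_⟩
    apply le_ciInf
    intro k
    by_cases hk : k < n
    · have := hB k hk
      have h1 := le_max_right 0 (t - τ k)
      have h2 : (0:ℝ) ≤ k := Nat.cast_nonneg k
      linarith
    · have h1 : (n : ℝ) ≤ k := by exact_mod_cast not_lt.1 hk
      have h2 := le_max_left 0 (t - τ k)
      linarith
  · intro k t ht
    refine (ciInf_le (hbdd t) k).trans ?_
    simp [max_eq_left (sub_nonpos.2 ht)]

lemma exists_levels {N : ℕ} (Ω : Set (Euc N)) (u : Euc N → ℝ)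
    (hu : AEMeasurable u (volume.restrict Ω)) : ∃ τ : ℕ → ℝ, ∀ n : ℕ,
      ((n : ℝ≥0∞) + 1) * (volume.restrict Ω) ({x | τ n < |u x|} ∩ ball 0 (n + 1)) ≤ 2⁻¹ ^ n := by
  have : ∀ n : ℕ, ∃ t : ℝ,
      ((n : ℝ≥0∞) + 1) * (volume.restrict Ω) ({x | t < |u x|} ∩ ball 0 (n + 1)) ≤ 2⁻¹ ^ n := by
    intro n
    have hm : ∀ t : ℝ, NullMeasurableSet {x | t < |u x|} (volume.restrict Ω) := fun t =>
      nullMeasurableSet_lt aemeasurable_const (continuous_abs.measurable.comp_aemeasurable hu)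
    have h1 := tendsto_measure_iInter_atTop (μ := volume.restrict Ω) (ι := ℕ)
      (s := fun k : ℕ => {x | (k : ℝ) < |u x|} ∩ ball 0 ((n : ℝ) + 1))
      (fun k => (hm k).inter measurableSet_ball.nullMeasurableSet)
      (by
        intro a b hab x hx
        have h0 : (a : ℝ) ≤ b := by exact_mod_cast hab
        have h1 : (b : ℝ) < |u x| := hx.1
        exact ⟨show (a : ℝ) < |u x| from lt_of_le_of_lt h0 h1, hx.2⟩)
      ⟨0, ((measure_mono inter_subset_right).trans_lt
        ((Measure.restrict_apply_le _ _).trans_lt measure_ball_lt_top)).ne⟩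
    have h2 : (⋂ k : ℕ, {x | (k : ℝ) < |u x|} ∩ ball 0 ((n : ℝ) + 1)) = ∅ := by
      rw [eq_empty_iff_forall_notMem]
      intro x hx
      obtain ⟨k, hk⟩ := exists_nat_ge |u x|
      exact absurd (mem_iInter.1 hx k).1 (not_lt.2 hk)
    rw [h2, measure_empty] at h1
    have h3 := ENNReal.Tendsto.const_mul (a := (n : ℝ≥0∞) + 1) h1 (Or.inr (by finiteness))
    rw [mul_zero] at h3
    have h4 : (0 : ℝ≥0∞) < 2⁻¹ ^ n := ENNReal.pow_pos (by simp) n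
    obtain ⟨k, hk⟩ := (h3.eventually_lt_const h4).exists
    exact ⟨k, hk.le⟩
  choose τ hτ using this
  exact ⟨τ, hτ⟩

lemma density_mono {N : ℕ} {A B : Set (Euc N)} {x : Euc N} (h : A ∩ ball x 1 ⊆ B)
    (hB : HasDensity B x 0) : HasDensity A x 0 := by
  unfold HasDensity at *
  rw [ENNReal.ofReal_zero] at *
  refine tendsto_of_tendsto_of_tendsto_of_le_of_le' tendsto_const_nhds hB
    (Eventually.of_forall fun _ => zero_le) ?_
  filter_upwards [Ioo_mem_nhdsGT (zero_lt_one (α := ℝ))] with ρ hρ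
  gcongr ?_ / _
  apply measure_mono
  intro y hy
  exact ⟨h ⟨hy.1, ball_subset_ball hρ.2.le hy.2⟩, hy.2⟩

lemma limit_top {N : ℕ} {Ω : Set (Euc N)} (hΩ : IsOpen Ω) {x : Euc N} (hx : x ∈ Ω)
    (v : Euc N → ℝ) (hv : ∀ s : ℝ, HasDensity {y | y ∈ Ω ∧ v y < s} x 0) :
    HasApproxLimitTop v Ω x := by
  constructor
  · unfold approxUpper
    rw [sInf_eq_top]
    rintro _ ⟨s, rfl, hs⟩
    exfalso
    have h1 := hv (s + 1)
    unfold HasDensity at hs h1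
    rw [ENNReal.ofReal_zero] at hs h1
    have h2 := hs.add h1
    rw [add_zero] at h2
    obtain ⟨ε, hε, hball⟩ := Metric.isOpen_iff.1 hΩ x hx
    have h3 := h2.eventually_lt_const (zero_lt_one (α := ℝ≥0∞))
    obtain ⟨ρ, h4, h5⟩ := (h3.and (Ioo_mem_nhdsGT hε)).exists
    refine absurd h4 (not_lt.2 ?_)
    have hb0 : volume (ball x ρ) ≠ 0 := (measure_ball_pos volume x h5.1).ne'
    rw [← ENNReal.add_div, ← ENNReal.div_self hb0 measure_ball_lt_top.ne]
    gcongr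
    refine le_trans (measure_mono ?_) (measure_union_le _ _)
    intro y hy
    have hyΩ := hball (ball_subset_ball h5.2.le hy)
    by_cases hys : s < v y
    · exact Or.inl ⟨⟨hyΩ, hys⟩, hy⟩
    · exact Or.inr ⟨⟨hyΩ, by linarith⟩, hy⟩
  · unfold approxLower
    rw [EReal.eq_top_iff_forall_lt]
    intro s
    refine lt_of_lt_of_le ?_ (le_sSup ⟨s + 1, rfl, hv (s + 1)⟩)
    exact_mod_cast lt_add_one s

lemma lower_density {N : ℕ} {Ω : Set (Euc N)} {x : Euc N} {u : Euc N → ℝ}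
    (h : approxLower u Ω x = ⊤) (s : ℝ) : HasDensity {y | y ∈ Ω ∧ u y < s} x 0 := by
  have h1 : (s : EReal) < approxLower u Ω x := by rw [h]; exact EReal.coe_lt_top s
  obtain ⟨_, ⟨t, rfl, ht⟩, hst⟩ := lt_sSup_iff.1 h1
  refine density_mono ?_ ht
  rintro y ⟨⟨hy, hys⟩, -⟩
  exact ⟨hy, hys.trans (by exact_mod_cast hst)⟩

lemma upper_density {N : ℕ} {Ω : Set (Euc N)} {x : Euc N} {u : Euc N → ℝ}
    (h : approxUpper u Ω x = ⊥) (s : ℝ) : HasDensity {y | y ∈ Ω ∧ s < u y} x 0 := by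
  have h1 : approxUpper u Ω x < (s : EReal) := by rw [h]; exact EReal.bot_lt_coe s
  obtain ⟨_, ⟨t, rfl, ht⟩, hst⟩ := sInf_lt_iff.1 h1
  refine density_mono ?_ ht
  rintro y ⟨⟨hy, hys⟩, -⟩
  exact ⟨hy, lt_trans (by exact_mod_cast hst) hys⟩

/-- if `C ⊆ Ω` is `GBV`-polar in the open set `Ω`, then there is a nonnegative
`u ∈ L¹(Ω) ∩ GBV(Ω)` whose approximate limit exists and equals `+∞` at every point of `C`. -/
theorem statement6 {N : ℕ} (Ω : Set (Euc N)) (hΩ : IsOpen Ω)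
    (C : Set (Euc N)) (hC : C ⊆ Ω) (hpolar : GBVPolar C Ω) :
    ∃ u : Euc N → ℝ, (∀ x, 0 ≤ u x) ∧ IntegrableOn u Ω volume ∧ MemGBV u Ω ∧
      C ⊆ {x | x ∈ Ω ∧ HasApproxLimitTop u Ω x} := by
  obtain ⟨u, ⟨hum, huBV⟩, hCu⟩ := hpolar
  obtain ⟨τ, hτ⟩ := exists_levels Ω u hum
  obtain ⟨f, hfL, hfT, hfk⟩ := exists_slow τ
  have hfc : Continuous f := by
    have : LipschitzWith 1 f := LipschitzWith.of_dist_le_mul fun a b => by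
      simpa [Real.dist_eq] using hfL a b
    exact this.continuous
  set v : Euc N → ℝ := fun x => max 0 (f |u x| - ‖x‖) with hv
  have hvm : AEMeasurable v (volume.restrict Ω) := by
    have h1 : AEMeasurable (fun x => f |u x|) (volume.restrict Ω) :=
      (hfc.comp continuous_abs).measurable.comp_aemeasurable hum
    exact aemeasurable_const.max (h1.sub continuous_norm.measurable.aemeasurable)
  have hv0 : ∀ x, 0 ≤ v x := fun x => le_max_left _ _
  refine ⟨v, hv0, ⟨hvm.aestronglyMeasurable, ?_⟩, ⟨hvm, ?_⟩, ?_⟩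
  · -- integrability
    rw [hasFiniteIntegral_iff_ofReal (Eventually.of_forall hv0)]
    set E : ℕ → Set (Euc N) := fun n => {x | τ n < |u x|} ∩ ball 0 (n + 1) with hE
    have hEm : ∀ n, NullMeasurableSet (E n) (volume.restrict Ω) := fun n =>
      (nullMeasurableSet_lt aemeasurable_const
        (continuous_abs.measurable.comp_aemeasurable hum)).inter
          measurableSet_ball.nullMeasurableSet
    have hpt : ∀ x, ENNReal.ofReal (v x) ≤
        ∑' n : ℕ, (E n).indicator (fun _ => ((n : ℝ≥0∞) + 1)) x := by
      intro x
      by_cases hx : f |u x| ≤ ‖x‖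
      · have : v x = 0 := max_eq_left (by linarith)
        simp [this]
      · push Not at hx
        have hpos : 0 < f |u x| := (norm_nonneg x).trans_lt hx
        obtain ⟨n, hn⟩ : ∃ n, ⌈f |u x|⌉₊ = n + 1 :=
          Nat.exists_eq_succ_of_ne_zero (Nat.ceil_pos.2 hpos).ne'
        have hn1 : (n : ℝ) < f |u x| := by
          apply Nat.lt_ceil.1; omega
        have hn2 : f |u x| ≤ n + 1 := by
          have := Nat.le_ceil (f |u x|)
          rw [hn] at this
          exact_mod_cast this
        have hxE : x ∈ E n := by
          refine ⟨?_, ?_⟩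
          · by_contra hcon
            exact absurd (hfk n _ (not_lt.1 hcon)) (not_le.2 hn1)
          · rw [mem_ball_zero_iff]; linarith
        refine le_trans ?_ (ENNReal.le_tsum n)
        rw [indicator_of_mem hxE]
        have : v x ≤ ((n + 1 : ℕ) : ℝ) := by
          push_cast
          exact max_le (by positivity) (by linarith [norm_nonneg x])
        calc ENNReal.ofReal (v x) ≤ ENNReal.ofReal ((n + 1 : ℕ) : ℝ) :=
              ENNReal.ofReal_le_ofReal this
          _ = (n : ℝ≥0∞) + 1 := by rw [ENNReal.ofReal_natCast]; push_cast; rfl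
    calc ∫⁻ x in Ω, ENNReal.ofReal (v x)
        ≤ ∫⁻ x in Ω, ∑' n : ℕ, (E n).indicator (fun _ => ((n : ℝ≥0∞) + 1)) x := lintegral_mono hpt
      _ = ∑' n : ℕ, ∫⁻ x in Ω, (E n).indicator (fun _ => ((n : ℝ≥0∞) + 1)) x :=
          lintegral_tsum fun n => aemeasurable_const.indicator₀ (hEm n)
      _ = ∑' n : ℕ, ((n : ℝ≥0∞) + 1) * (volume.restrict Ω) (E n) := by
          congr 1; funext n
          rw [lintegral_indicator_const₀ (hEm n)]
      _ ≤ ∑' n : ℕ, 2⁻¹ ^ n := ENNReal.tsum_le_tsum hτ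
      _ < ⊤ := by
          rw [ENNReal.tsum_geometric]
          simp
  · -- truncations
    intro m hm O hO hOc hOΩ
    set K := closure O with hK
    obtain ⟨δ, hδ, hδΩ⟩ := hOc.exists_cthickening_subset_open hΩ hOΩ
    set U := thickening δ K with hU
    have hclU : closure U ⊆ cthickening δ K := closure_thickening_subset_cthickening δ K
    have hclUc : IsCompact (closure U) := hOc.cthickening.of_isClosed_subset isClosed_closure hclU
    have hUΩ : U ⊆ Ω := subset_closure.trans (hclU.trans hδΩ)
    have hUfin : volume U < ⊤ := (measure_mono subset_closure).trans_lt hclUc.measure_lt_top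
    obtain ⟨R, hR⟩ := hclUc.isBounded.exists_norm_le
    obtain ⟨T, hT⟩ := hfT (m + R)
    set M := max T 1 with hM
    have hMpos : 0 < M := lt_of_lt_of_le one_pos (le_max_right _ _)
    have hfM : ∀ t, M ≤ t → m + R ≤ f t := fun t ht => hT t ((le_max_left _ _).trans ht)
    obtain ⟨hwi, hwV⟩ := huBV M hMpos U isOpen_thickening hclUc (hclU.trans hδΩ)
    set w : Euc N → ℝ := fun x => max (-M) (min (u x) M) with hw
    set z : Euc N → ℝ := fun x => max (-m) (min (v x) m) with hz
    have hzm : AEMeasurable z (volume.restrict U) :=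
      aemeasurable_const.max ((hvm.mono_measure (Measure.restrict_mono hUΩ le_rfl)).min
        aemeasurable_const)
    have hzb : ∀ x, ‖z x‖ ≤ m := fun x => by
      rw [Real.norm_eq_abs, abs_le]
      exact ⟨le_max_left _ _, max_le (by linarith) (min_le_right _ _)⟩
    have hzi : IntegrableOn z U volume :=
      IntegrableOn.of_bound hUfin hzm.aestronglyMeasurable m (Eventually.of_forall hzb)
    have hOU : O ⊆ U := subset_closure.trans (self_subset_thickening hδ K)
    have hzeq : ∀ x ∈ U, z x = max (-m) (min (max 0 (f |w x| - ‖x‖)) m) := by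
      intro x hx
      by_cases hxM : |u x| ≤ M
      · have h1 := abs_le.1 hxM
        have : w x = u x := by
          simp only [hw]
          rw [min_eq_left h1.2, max_eq_right h1.1]
        rw [this]
      · push Not at hxM
        have h1 : |w x| = M := by
          rcases lt_abs.1 hxM with h | h
          · simp only [hw]
            rw [min_eq_right h.le, max_eq_right (by linarith), abs_of_pos hMpos]
          · simp only [hw]
            rw [min_eq_left (by linarith), max_eq_left (by linarith), abs_neg, abs_of_pos hMpos]
        have h2 := hfM _ hxM.le
        have h3 := hfM _ le_rfl
        have h4 := hR x (subset_closure hx)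
        simp only [hz, hv]
        rw [h1, min_eq_right (le_max_of_le_right (by linarith)),
          min_eq_right (le_max_of_le_right (by linarith))]
    refine ⟨hzi.mono_set hOU, ?_⟩
    refine lem_comp O K hO hOc subset_closure δ hδ w z hwi hwV hzi ?_
    intro x hx y hy
    rw [hzeq x hx, hzeq y hy]
    have a1 : ∀ a b c : ℝ, |max c a - max c b| ≤ |a - b| := fun a b c => by
      simpa [max_comm] using abs_max_sub_max_le_abs a b c
    have a2 : ∀ a b c : ℝ, |min a c - min b c| ≤ |a - b| := fun a b c => by
      simpa using abs_min_sub_min_le_max a c b c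
    refine (a1 _ _ _).trans ((a2 _ _ _).trans ((a1 _ _ _).trans ?_))
    have b1 := (hfL |w x| |w y|).trans (abs_abs_sub_abs_le (w x) (w y))
    have b2 := abs_norm_sub_norm_le x y
    rw [abs_le] at b1 b2 ⊢
    constructor <;> linarith [b1.1, b1.2, b2.1, b2.2]
  · -- approximate limit
    intro x hx
    refine ⟨hC hx, limit_top hΩ (hC hx) v fun s => ?_⟩
    obtain ⟨T, hT⟩ := hfT (s + (‖x‖ + 1))
    have key : ∀ y, y ∈ ball x 1 → v y < s → |u y| < T := by
      intro y hy hys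
      by_contra hcon
      have h1 := hT _ (not_lt.1 hcon)
      have h2 : f |u y| - ‖y‖ ≤ v y := le_max_right _ _
      have h3 : ‖y‖ ≤ ‖x‖ + 1 := by
        have := norm_le_norm_add_norm_sub' y x
        rw [mem_ball, dist_eq_norm] at hy
        linarith
      linarith
    rcases (hCu hx).2 with ⟨-, h⟩ | ⟨h, -⟩
    · refine density_mono ?_ (lower_density h T)
      rintro y ⟨⟨hy, hys⟩, hyb⟩
      exact ⟨hy, (abs_lt.1 (key y hyb hys)).2⟩
    · refine density_mono ?_ (upper_density h (-T))
      rintro y ⟨⟨hy, hys⟩, hyb⟩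
      exact ⟨hy, (abs_lt.1 (key y hyb hys)).1⟩
end
end

section
/- Let Ω ⊆ ℝ^N be open and C ⊆ Ω. Then C is GBV-polar in Ω if and only if there exists a sequence {A_k} of measurable sets with locally finite perimeter in Ω such that λ^N(A_k) → 0 and θ(A_k, x) = 1 for every x ∈ C and every k. -/
open MeasureTheory Metric Filter Set
open scoped ENNReal Topology symmDiff

noncomputable section

variable {N : ℕ}

theorem prim_hasFDerivAt (g : Euc N → ℝ) (hg : ContDiff ℝ 1 g) (hc : HasCompactSupport g)
    (t : ℝ) (e y : Euc N) :
    HasFDerivAt (fun y => ∫ s in (0:ℝ)..t, g (y - s • e))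
      (∫ s in (0:ℝ)..t, fderiv ℝ g (y - s • e)) y := by
  have hd : Continuous (fderiv ℝ g) := hg.continuous_fderiv (by norm_num)
  obtain ⟨B, hB⟩ := (hc.fderiv (𝕜 := ℝ)).exists_bound_of_continuous hd
  refine intervalIntegral.hasFDerivAt_integral_of_dominated_of_fderiv_le
    (F := fun y s => g (y - s • e)) (F' := fun y s => fderiv ℝ g (y - s • e))
    (bound := fun _ => B) (s := univ) univ_mem ?_ ?_ ?_ ?_ ?_ ?_
  · refine Eventually.of_forall fun x => Continuous.aestronglyMeasurable ?_
    exact hg.continuous.comp (by fun_prop)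
  · exact (hg.continuous.comp (by fun_prop)).intervalIntegrable _ _
  · exact (hd.comp (by fun_prop)).aestronglyMeasurable
  · exact ae_of_all _ fun s _ x _ => hB _
  · exact intervalIntegrable_const
  · refine ae_of_all _ fun s _ x _ => ?_
    have h1 : HasFDerivAt g (fderiv ℝ g (x - s • e)) (x - s • e) :=
      (hg.differentiable (by norm_num) _).hasFDerivAt
    exact h1.comp x ((hasFDerivAt_id x).sub_const (s • e))

theorem prim_contDiff (g : Euc N → ℝ) (hg : ContDiff ℝ 1 g) (hc : HasCompactSupport g)
    (t : ℝ) (e : Euc N) :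
    ContDiff ℝ 1 (fun y => ∫ s in (0:ℝ)..t, g (y - s • e)) := by
  rw [contDiff_one_iff_fderiv]
  refine ⟨fun y => (prim_hasFDerivAt g hg hc t e y).differentiableAt, ?_⟩
  have : fderiv ℝ (fun y => ∫ s in (0:ℝ)..t, g (y - s • e)) =
      fun y => ∫ s in (0:ℝ)..t, fderiv ℝ g (y - s • e) := by
    ext1 y; exact (prim_hasFDerivAt g hg hc t e y).fderiv
  rw [this]
  have hd : Continuous (fderiv ℝ g) := hg.continuous_fderiv (by norm_num)
  exact intervalIntegral.continuous_parametric_intervalIntegral_of_continuous'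
    (f := fun y s => fderiv ℝ g (y - s • e)) (hd.comp (by fun_prop)) 0 t

theorem prim_dir (g : Euc N → ℝ) (hg : ContDiff ℝ 1 g) (hc : HasCompactSupport g)
    (t : ℝ) (e y : Euc N) :
    fderiv ℝ (fun y => ∫ s in (0:ℝ)..t, g (y - s • e)) y e = g y - g (y - t • e) := by
  rw [(prim_hasFDerivAt g hg hc t e y).fderiv]
  have hd : Continuous (fderiv ℝ g) := hg.continuous_fderiv (by norm_num)
  have hii : IntervalIntegrable (fun s : ℝ => fderiv ℝ g (y - s • e)) volume 0 t :=
    (hd.comp (by fun_prop : Continuous fun s : ℝ => y - s • e)).intervalIntegrable _ _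
  rw [ContinuousLinearMap.intervalIntegral_apply hii]
  have h := intervalIntegral.integral_eq_sub_of_hasDerivAt (a := 0) (b := t)
    (f := fun s : ℝ => - g (y - s • e)) (f' := fun s => fderiv ℝ g (y - s • e) e) ?_ ?_
  · rw [h]; simp; ring
  · intro s _
    have h1 : HasFDerivAt g (fderiv ℝ g (y - s • e)) (y - s • e) :=
      (hg.differentiable (by norm_num) _).hasFDerivAt
    have h2 : HasDerivAt (fun s : ℝ => y - s • e) (-e) s := by
      simpa using ((hasDerivAt_id s).smul_const e).const_sub y
    have := (h1.comp_hasDerivAt s h2).neg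
    rw [map_neg, neg_neg] at this
    exact this
  · exact ((hd.comp (by fun_prop)).clm_apply continuous_const).intervalIntegrable _ _

theorem diverg_smul (f : Euc N → ℝ) (hf : Differentiable ℝ f) (i : Fin N) (y : Euc N) :
    diverg (fun y => f y • EuclideanSpace.single i (1:ℝ)) y =
      fderiv ℝ f y (EuclideanSpace.single i 1) := by
  unfold diverg
  have : ∀ j : Fin N, fderiv ℝ (fun y => f y • EuclideanSpace.single i (1:ℝ)) y
      (EuclideanSpace.single j 1) j =
      fderiv ℝ f y (EuclideanSpace.single j 1) * (if j = i then 1 else 0) := by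
    intro j
    have h := ((hf y).hasFDerivAt.smul_const (EuclideanSpace.single i (1:ℝ))).fderiv
    rw [h]
    simp
  simp [this]

theorem diverg_continuous (φ : Euc N → Euc N) (hφ : ContDiff ℝ 1 φ) : Continuous (diverg φ) := by
  have hd : Continuous (fderiv ℝ φ) := hφ.continuous_fderiv (by norm_num)
  unfold diverg
  refine continuous_finsetSum _ fun i _ => ?_
  have h : Continuous fun x => fderiv ℝ φ x (EuclideanSpace.single i 1) :=
    hd.clm_apply continuous_const
  fun_prop

theorem diverg_zero_of_notMem (φ : Euc N → Euc N) (x : Euc N) (hx : x ∉ tsupport φ) :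
    diverg φ x = 0 := by
  unfold diverg
  have : fderiv ℝ φ x = 0 := by
    by_contra h
    exact hx (support_fderiv_subset ℝ (f := φ) h)
  simp [this]

theorem exists_mollify (σ : Euc N → ℝ) (hσ : Measurable σ) (h1 : ∀ x, |σ x| ≤ 1)
    (K : Set (Euc N)) (hK : IsCompact K) (h0 : ∀ x, x ∉ K → σ x = 0) (r : ℝ) (hr : 0 < r) :
    ∃ g : ℕ → Euc N → ℝ, (∀ n, ContDiff ℝ 1 (g n) ∧ (∀ x, |g n x| ≤ 1) ∧
      ∀ x, g n x ≠ 0 → x ∈ cthickening r K) ∧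
      ∀ᵐ x, Tendsto (fun n => g n x) atTop (𝓝 (σ x)) := by
  have hpos : ∀ n : ℕ, 0 < r / ((n:ℝ) + 1) := fun n => by positivity
  let b : ℕ → ContDiffBump (0 : Euc N) := fun n =>
    ⟨r / ((n:ℝ) + 1) / 2, r / ((n:ℝ) + 1), half_pos (hpos n), half_lt_self (hpos n)⟩
  have hIntg : Integrable σ := by
    have : IntegrableOn σ K := by
      refine Measure.integrableOn_of_bounded (M := 1) hK.measure_lt_top.ne
        hσ.aestronglyMeasurable (ae_of_all _ fun x => h1 x)
    rwa [integrableOn_iff_integrable_of_support_subset] at this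
    intro x hx
    by_contra h
    exact hx (h0 x h)
  refine ⟨fun n => MeasureTheory.convolution ((b n).normed volume) σ
    (ContinuousLinearMap.lsmul ℝ ℝ) volume, fun n => ⟨?_, ?_, ?_⟩, ?_⟩
  · exact (b n).hasCompactSupport_normed.contDiff_convolution_left (n := 1) _
      (b n).contDiff_normed hIntg.locallyIntegrable
  · intro x
    have := dist_convolution_le (μ := volume) (f := (b n).normed volume) (g := σ) (x₀ := x)
      (z₀ := 0) (ε := 1) zero_le_one ((b n).support_normed_eq (μ := volume)).subset
      (b n).nonneg_normed (b n).integral_normed hσ.aestronglyMeasurable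
      (fun y _ => by simpa using h1 y)
    simpa using this
  · intro x hx
    have hx' := support_convolution_subset (μ := volume) (ContinuousLinearMap.lsmul ℝ ℝ) hx
    obtain ⟨y, hy, z, hz, rfl⟩ := hx'
    rw [(b n).support_normed_eq] at hy
    have hzK : z ∈ K := by
      by_contra h
      exact hz (h0 z h)
    refine mem_cthickening_of_dist_le _ z r K hzK ?_
    have h2 : ‖y‖ < r / ((n:ℝ) + 1) := by simpa using hy
    have h3 : r / ((n:ℝ) + 1) ≤ r := div_le_self hr.le (by linarith [n.cast_nonneg (α := ℝ)])
    simp only [dist_eq_norm, add_sub_cancel_right]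
    linarith
  · refine ContDiffBump.ae_convolution_tendsto_right_of_locallyIntegrable (K := 2) ?_ ?_
      hIntg.locallyIntegrable
    · change Tendsto (fun n : ℕ => r / ((n:ℝ) + 1)) atTop (𝓝 0)
      exact tendsto_const_nhds.div_atTop
        (tendsto_atTop_add_const_right _ _ tendsto_natCast_atTop_atTop)
    · refine Eventually.of_forall fun n => ?_
      change r / ((n:ℝ) + 1) ≤ 2 * (r / ((n:ℝ) + 1) / 2)
      linarith

theorem test_bound (w : Euc N → ℝ) (hw : Measurable w) (M : ℝ) (hM : ∀ x, |w x| ≤ M)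
    (Ω' L : Set (Euc N)) (hL : IsCompact L) (hLΩ : L ⊆ Ω') (i : Fin N)
    (g : Euc N → ℝ) (hg : ContDiff ℝ 1 g) (hc : HasCompactSupport g) (hg1 : ∀ x, |g x| ≤ 1)
    (t : ℝ) (ht : 0 < t)
    (hsupp : ∀ y, ∀ s ∈ Icc (0:ℝ) t, g (y - s • EuclideanSpace.single i (1:ℝ)) ≠ 0 → y ∈ L) :
    ENNReal.ofReal (∫ x, g x * (w (x + t • EuclideanSpace.single i (1:ℝ)) - w x)) ≤
      variation w Ω' * ENNReal.ofReal t := by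
  set e : Euc N := EuclideanSpace.single i (1:ℝ) with he
  set Φ : Euc N → ℝ := fun y => ∫ s in (0:ℝ)..t, g (y - s • e) with hΦ
  have hΦc : ContDiff ℝ 1 Φ := prim_contDiff g hg hc t e
  set f : Euc N → ℝ := fun y => (-(1/t)) * Φ y with hf
  have hfc : ContDiff ℝ 1 f := contDiff_const.mul hΦc
  set φ : Euc N → Euc N := fun y => f y • e with hφ
  have hdiv : ∀ y, t * diverg φ y = g (y - t • e) - g y := by
    intro y
    rw [hφ, diverg_smul f (hfc.differentiable (by norm_num)) i y, hf,
      fderiv_const_mul (hΦc.differentiable (by norm_num) y)]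
    have := prim_dir g hg hc t e y
    simp only [_root_.smul_apply, smul_eq_mul, ← he]
    rw [this]
    field_simp
    ring
  have hsub : tsupport φ ⊆ L := by
    refine closure_minimal ?_ hL.isClosed
    intro y hy
    by_contra hyL
    apply hy
    have : Φ y = 0 := by
      rw [hΦ]
      refine (intervalIntegral.integral_congr (g := fun _ => (0:ℝ)) ?_).trans (by simp)
      intro s hs
      rw [uIcc_of_le ht.le] at hs
      by_contra h
      exact hyL (hsupp y s hs h)
    simp [hφ, hf, this]
  have htest : φ ∈ TestVF Ω' := by
    refine ⟨hfc.smul contDiff_const, HasCompactSupport.of_support_subset_isCompact hL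
      ((subset_tsupport _).trans hsub), hsub.trans hLΩ, fun y => ?_⟩
    have h1 : ‖Φ y‖ ≤ 1 * |t - 0| := intervalIntegral.norm_integral_le_of_norm_le_const
      fun s _ => hg1 _
    have h2 : ‖e‖ = 1 := by simp [he]
    rw [hφ, norm_smul, h2, mul_one, hf, norm_mul, norm_neg, norm_div, norm_one, Real.norm_of_nonneg ht.le]
    rw [sub_zero, one_mul, abs_of_pos ht] at h1
    rw [div_mul_eq_mul_div, one_mul, div_le_one ht]
    exact h1
  have hgi : Integrable g := hg.continuous.integrable_of_hasCompactSupport hc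
  have hgi' : Integrable (fun y => g (y - t • e)) := hgi.comp_sub_right (t • e)
  have hi1 : Integrable (fun y => g y * w y) :=
    hgi.mul_bdd (c := M) hw.aestronglyMeasurable (ae_of_all _ hM)
  have hi2 : Integrable (fun y => g (y - t • e) * w y) :=
    hgi'.mul_bdd (c := M) hw.aestronglyMeasurable (ae_of_all _ hM)
  have hi3 : Integrable (fun y => g y * w (y + t • e)) := by
    have := hi2.comp_add_right (t • e)
    simpa using this
  have key : ∫ x, g x * (w (x + t • e) - w x) = t * ∫ x in Ω', w x * diverg φ x := by
    have h1 : ∫ x, g x * (w (x + t • e) - w x) = (∫ x, g x * w (x + t • e)) - ∫ x, g x * w x := by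
      rw [← integral_sub hi3 hi1]
      simp only [mul_sub]
    have h2 : ∫ x, g x * w (x + t • e) = ∫ x, g (x - t • e) * w x := by
      rw [← integral_add_right_eq_self (fun x => g (x - t • e) * w x) (t • e)]
      simp
    rw [h1, h2, ← integral_sub hi2 hi1]
    rw [setIntegral_eq_integral_of_forall_compl_eq_zero, ← integral_const_mul]
    · congr 1
      ext x
      rw [mul_left_comm, hdiv]
      ring
    · intro x hx
      rw [diverg_zero_of_notMem φ x fun h => hx (hLΩ (hsub h)), mul_zero]
  rw [key, ENNReal.ofReal_mul ht.le, mul_comm]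
  gcongr
  exact le_iSup₂_of_le (f := fun φ (_ : φ ∈ TestVF Ω') =>
    ENNReal.ofReal (∫ x in Ω', w x * diverg φ x)) φ htest le_rfl

theorem dq_of_variation (w : Euc N → ℝ) (hw : Measurable w) (M : ℝ) (hM : ∀ x, |w x| ≤ M)
    (Ω' K : Set (Euc N)) (hΩ' : IsOpen Ω') (hK : IsCompact K) (hKΩ : K ⊆ Ω') (i : Fin N) :
    ∃ δ > 0, ∀ t, 0 < t → t < δ →
      ∫⁻ x in K, ‖w (x + t • EuclideanSpace.single i (1:ℝ)) - w x‖ₑ ≤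
        variation w Ω' * ENNReal.ofReal t := by
  obtain ⟨δ, hδ, hsub⟩ := hK.exists_cthickening_subset_open hΩ' hKΩ
  refine ⟨δ / 2, half_pos hδ, fun t ht htδ => ?_⟩
  set e : Euc N := EuclideanSpace.single i (1:ℝ) with he
  have hen : ‖e‖ = 1 := by simp [he]
  set d : Euc N → ℝ := fun x => w (x + t • e) - w x with hd
  have hdm : Measurable d := (hw.comp (measurable_id.add_const _)).sub hw
  have hdb : ∀ x, |d x| ≤ 2 * M := fun x => by
    have h1 := abs_sub (w (x + t • e)) (w x)
    linarith [hM x, hM (x + t • e)]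
  set σ : Euc N → ℝ := K.indicator (fun x => if 0 ≤ d x then 1 else -1) with hσ
  have hσm : Measurable σ :=
    (Measurable.ite (measurableSet_le measurable_const hdm) measurable_const
      measurable_const).indicator hK.measurableSet
  have hσ1 : ∀ x, |σ x| ≤ 1 := fun x => by
    by_cases hx : x ∈ K
    · simp only [hσ, indicator_of_mem hx]
      split_ifs <;> simp
    · simp [hσ, indicator_of_notMem hx]
  obtain ⟨g, hg, hlim⟩ := exists_mollify σ hσm hσ1 K hK
    (fun x hx => indicator_of_notMem hx _) (δ/2) (half_pos hδ)
  have hKc : IsCompact (cthickening (δ/2) K) := hK.cthickening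
  have hc : ∀ n, HasCompactSupport (g n) := fun n =>
    HasCompactSupport.of_support_subset_isCompact hKc fun x hx => (hg n).2.2 x hx
  have hbd : ∀ n, ENNReal.ofReal (∫ x, g n x * d x) ≤ variation w Ω' * ENNReal.ofReal t := by
    intro n
    refine test_bound w hw M hM Ω' (cthickening δ K) hK.cthickening hsub i (g n) (hg n).1 (hc n)
      (hg n).2.1 t ht ?_
    intro y s hs hne
    have h1 := (hg n).2.2 _ hne
    have h2 : y ∈ cthickening (δ/2) (cthickening (δ/2) K) := by
      refine mem_cthickening_of_dist_le _ _ _ _ h1 ?_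
      rw [dist_eq_norm, sub_sub_cancel, norm_smul, ← he, hen, mul_one, Real.norm_of_nonneg hs.1]
      linarith [hs.2]
    have h3 := cthickening_cthickening_subset (half_pos hδ).le (half_pos hδ).le K h2
    simpa using h3
  have hT : Tendsto (fun n => ∫ x, g n x * d x) atTop (𝓝 (∫ x, σ x * d x)) := by
    refine tendsto_integral_of_dominated_convergence
      ((cthickening (δ/2) K).indicator fun _ => 2 * M) ?_ ?_ ?_ ?_
    · intro n
      exact ((hg n).1.continuous.aestronglyMeasurable).mul hdm.aestronglyMeasurable
    · exact (integrable_indicator_iff hKc.measurableSet).2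
        (integrableOn_const hKc.measure_lt_top.ne)
    · refine fun n => ae_of_all _ fun x => ?_
      by_cases hx : x ∈ cthickening (δ/2) K
      · rw [indicator_of_mem hx, norm_mul]
        have h1 := (hg n).2.1 x
        have h2 := hdb x
        simp only [Real.norm_eq_abs]
        nlinarith [abs_nonneg (d x), abs_nonneg (g n x)]
      · rw [indicator_of_notMem hx]
        have : g n x = 0 := by
          by_contra h
          exact hx ((hg n).2.2 x h)
        simp [this]
    · filter_upwards [hlim] with x hx
      exact hx.mul_const _
  have hfin : ENNReal.ofReal (∫ x, σ x * d x) ≤ variation w Ω' * ENNReal.ofReal t :=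
    le_of_tendsto' ((ENNReal.continuous_ofReal.tendsto _).comp hT) hbd
  have heq : ∫ x, σ x * d x = ∫ x in K, |d x| := by
    rw [← integral_indicator hK.measurableSet]
    congr 1
    ext x
    by_cases hx : x ∈ K
    · simp only [hσ, indicator_of_mem hx]
      split_ifs with h
      · rw [abs_of_nonneg h, one_mul]
      · rw [abs_of_neg (not_le.1 h)]; ring
    · simp [hσ, indicator_of_notMem hx]
  refine le_trans (le_of_eq ?_) hfin
  rw [heq]
  have hdi : IntegrableOn d K :=
    Measure.integrableOn_of_bounded (M := 2 * M) hK.measure_lt_top.ne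
        hdm.aestronglyMeasurable (ae_of_all _ fun x => hdb x)
  have := ofReal_integral_norm_eq_lintegral_enorm hdi
  simpa [hd] using this.symm

theorem scalar_bound (w : Euc N → ℝ) (hw : Measurable w) (M : ℝ) (hM : ∀ x, |w x| ≤ M)
    (K : Set (Euc N)) (hK : IsCompact K) (C : ℝ≥0∞) (hC : C ≠ ⊤) (e : Euc N)
    (h : ∃ᶠ n : ℕ in atTop, ∫⁻ x in K, ‖w (x + (1 / ((n:ℝ) + 1)) • e) - w x‖ₑ ≤
      C * ENNReal.ofReal (1 / ((n:ℝ) + 1)))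
    (f : Euc N → ℝ) (hf : ContDiff ℝ 1 f) (hc : HasCompactSupport f) (hfK : tsupport f ⊆ K)
    (hf1 : ∀ x, |f x| ≤ 1) :
    ∫ x, w x * fderiv ℝ f x e ≤ C.toReal := by
  have hfK0 : ∀ x, x ∉ K → f x = 0 := fun x hx => image_eq_zero_of_notMem_tsupport fun h' => hx (hfK h')
  obtain ⟨L, hL⟩ := hf.lipschitzWith_of_hasCompactSupport hc (by norm_num)
  have hM0 : 0 ≤ M := (abs_nonneg _).trans (hM 0)
  set K' := cthickening ‖e‖ K with hK'
  have hK'c : IsCompact K' := hK.cthickening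
  have hT : Tendsto (fun n : ℕ => ∫ x, w x * (((n:ℝ) + 1) * (f x - f (x - (1 / ((n:ℝ) + 1)) • e))))
      atTop (𝓝 (∫ x, w x * fderiv ℝ f x e)) := by
    refine tendsto_integral_of_dominated_convergence
      (K'.indicator fun _ => M * (L * ‖e‖)) ?_ ?_ ?_ ?_
    · intro n
      refine hw.aestronglyMeasurable.mul (Continuous.aestronglyMeasurable ?_)
      have := hf.continuous
      fun_prop
    · exact (integrable_indicator_iff hK'c.measurableSet).2
        (integrableOn_const hK'c.measure_lt_top.ne)
    · refine fun n => ae_of_all _ fun x => ?_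
      have hn : (0:ℝ) < (n:ℝ) + 1 := by positivity
      by_cases hx : x ∈ K'
      · rw [indicator_of_mem hx, norm_mul, norm_mul, Real.norm_of_nonneg hn.le]
        have h1 : ‖f x - f (x - (1 / ((n:ℝ) + 1)) • e)‖ ≤ L * (1 / ((n:ℝ) + 1) * ‖e‖) := by
          have := hL.dist_le_mul x (x - (1 / ((n:ℝ) + 1)) • e)
          have hp : (0:ℝ) ≤ 1 / ((n:ℝ) + 1) := by positivity
          rw [dist_eq_norm, dist_eq_norm, sub_sub_cancel, norm_smul,
            Real.norm_of_nonneg hp] at this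
          exact this
        have h2 : ((n:ℝ)+1) * ‖f x - f (x - (1 / ((n:ℝ) + 1)) • e)‖ ≤ L * ‖e‖ := by
          calc _ ≤ ((n:ℝ)+1) * (L * (1 / ((n:ℝ) + 1) * ‖e‖)) := by gcongr
            _ = L * ‖e‖ := by field_simp
        exact mul_le_mul (hM x) h2 (by positivity) hM0
      · rw [indicator_of_notMem hx]
        have h1 : f x = 0 := hfK0 x fun h' => hx (self_subset_cthickening _ h')
        have h2 : f (x - (1 / ((n:ℝ) + 1)) • e) = 0 := by
          refine hfK0 _ fun h' => hx ?_
          refine mem_cthickening_of_dist_le _ _ _ _ h' ?_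
          rw [dist_eq_norm, sub_sub_cancel, norm_smul, Real.norm_of_nonneg (by positivity)]
          have : 1 / ((n:ℝ)+1) ≤ 1 := by
            rw [div_le_one hn]; linarith [n.cast_nonneg (α := ℝ)]
          exact mul_le_of_le_one_left (norm_nonneg _) this
        rw [h1, h2]; simp
    · refine ae_of_all _ fun x => Tendsto.const_mul _ ?_
      have h1 : HasFDerivAt f (fderiv ℝ f x) x := (hf.differentiable (by norm_num) x).hasFDerivAt
      have hcn : Tendsto (fun n : ℕ => ‖(n:ℝ) + 1‖) atTop atTop :=
        tendsto_norm_atTop_atTop.comp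
          (tendsto_atTop_add_const_right _ _ tendsto_natCast_atTop_atTop)
      have h2 := (h1.lim (-e) (c := fun n : ℕ => (n:ℝ) + 1) hcn).neg
      rw [map_neg, neg_neg] at h2
      refine h2.congr fun n => ?_
      simp only [smul_eq_mul, smul_neg, one_div, sub_eq_add_neg]
      ring
  refine le_of_tendsto_of_frequently hT (h.mono fun n hn => ?_)
  have hnp : (0:ℝ) < (n:ℝ) + 1 := by positivity
  set a : Euc N := (1 / ((n:ℝ) + 1)) • e with ha
  have hfi : Integrable f := hf.continuous.integrable_of_hasCompactSupport hc
  have hi1 : Integrable (fun y => f y * w y) :=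
    hfi.mul_bdd (c := M) hw.aestronglyMeasurable (ae_of_all _ hM)
  have hi2 : Integrable (fun y => f (y - a) * w y) :=
    (hfi.comp_sub_right a).mul_bdd (c := M) hw.aestronglyMeasurable (ae_of_all _ hM)
  have hi3 : Integrable (fun y => f y * w (y + a)) := by
    have := hi2.comp_add_right a
    simpa using this
  have hdm : Measurable fun x => w (x + a) - w x := (hw.comp (measurable_id.add_const _)).sub hw
  have hdi : IntegrableOn (fun x => w (x + a) - w x) K :=
    Measure.integrableOn_of_bounded (M := 2 * M) hK.measure_lt_top.ne
        hdm.aestronglyMeasurable (ae_of_all _ fun x => by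
          have h1 := abs_sub (w (x + a)) (w x)
          rw [Real.norm_eq_abs]
          linarith [hM x, hM (x + a)])
  have h1 : ∫ x, w x * (((n:ℝ) + 1) * (f x - f (x - a))) =
      ((n:ℝ)+1) * ∫ x in K, f x * (w x - w (x + a)) := by
    rw [setIntegral_eq_integral_of_forall_compl_eq_zero
      (fun x hx => by rw [hfK0 x hx, zero_mul])]
    have h2 : ∫ x, f x * w (x + a) = ∫ x, f (x - a) * w x := by
      rw [← integral_add_right_eq_self (fun x => f (x - a) * w x) a]
      simp
    have h3 : ∫ x, f x * (w x - w (x + a)) = ∫ x, (f x * w x - f (x - a) * w x) := by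
      rw [integral_sub hi1 hi2, ← h2, ← integral_sub hi1 hi3]
      simp only [mul_sub]
    rw [h3, ← integral_const_mul]
    congr 1
    ext x
    ring
  have h4 : ∫ x in K, f x * (w x - w (x + a)) ≤ ∫ x in K, ‖w (x + a) - w x‖ := by
    have hi : Integrable fun x => f x * (w x - w (x + a)) := by
      simp only [mul_sub]
      exact hi1.sub hi3
    refine integral_mono hi.integrableOn hdi.norm fun x => ?_
    have e1 : f x * (w x - w (x + a)) ≤ |f x| * |w x - w (x + a)| := by
      rw [← abs_mul]; exact le_abs_self _
    have e2 : |f x| * |w x - w (x + a)| ≤ 1 * |w x - w (x + a)| := by gcongr; exact hf1 x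
    rw [one_mul, abs_sub_comm] at e2
    exact e1.trans (by simpa only [abs_sub_comm, Real.norm_eq_abs] using e2)
  have h5 : ∫ x in K, ‖w (x + a) - w x‖ ≤ C.toReal * (1 / ((n:ℝ) + 1)) := by
    rw [integral_norm_eq_lintegral_enorm hdi.1]
    have := ENNReal.toReal_mono (ENNReal.mul_ne_top hC ENNReal.ofReal_ne_top) hn
    rwa [ENNReal.toReal_mul, ENNReal.toReal_ofReal (by positivity)] at this
  rw [h1]
  calc _ ≤ ((n:ℝ)+1) * (C.toReal * (1 / ((n:ℝ) + 1))) := by gcongr; exact h4.trans h5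
    _ = C.toReal := by field_simp

/-- frequent difference quotient bound along `1/(n+1)` in the coordinate directions -/
def FreqDQ (w : Euc N → ℝ) (K : Set (Euc N)) : Prop :=
  ∀ i : Fin N, ∃ C : ℝ≥0∞, C ≠ ⊤ ∧ ∃ᶠ n : ℕ in atTop,
    ∫⁻ x in K, ‖w (x + (1 / ((n:ℝ) + 1)) • EuclideanSpace.single i (1:ℝ)) - w x‖ₑ ≤
      C * ENNReal.ofReal (1 / ((n:ℝ) + 1))

theorem FreqDQ.bound (w : Euc N → ℝ) (hw : Measurable w) (M : ℝ) (hM : ∀ x, |w x| ≤ M)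
    (K : Set (Euc N)) (hK : IsCompact K) (h : FreqDQ w K) :
    ∃ B : ℝ, ∀ φ : Euc N → Euc N, ContDiff ℝ 1 φ → HasCompactSupport φ → tsupport φ ⊆ K →
      (∀ x, ‖φ x‖ ≤ 1) → ∫ x, w x * diverg φ x ≤ B := by
  choose C hC hfr using h
  refine ⟨∑ i, (C i).toReal, fun φ hφ hc hs h1 => ?_⟩
  have hcoord : ∀ i : Fin N, ContDiff ℝ 1 (fun x => φ x i) := fun i => by fun_prop
  have hsub : ∀ i : Fin N, tsupport (fun x => φ x i) ⊆ tsupport φ := fun i => by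
    refine closure_mono fun x hx h0 => hx ?_
    simp [show φ x = 0 from h0]
  have hcs : ∀ i : Fin N, HasCompactSupport (fun x => φ x i) := fun i =>
    hc.of_isClosed_subset (isClosed_tsupport _) (hsub i)
  have hfd : ∀ (i : Fin N) x, fderiv ℝ φ x (EuclideanSpace.single i 1) i =
      fderiv ℝ (fun x => φ x i) x (EuclideanSpace.single i 1) := by
    intro i x
    have h1 : HasFDerivAt φ (fderiv ℝ φ x) x := (hφ.differentiable (by norm_num) x).hasFDerivAt
    have h2 := ((EuclideanSpace.proj i : Euc N →L[ℝ] ℝ).hasFDerivAt (x := φ x)).comp x h1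
    have h3 : HasFDerivAt (fun x => φ x i)
      ((EuclideanSpace.proj i : Euc N →L[ℝ] ℝ).comp (fderiv ℝ φ x)) x := h2
    rw [h3.fderiv]
    rfl
  have hIntg : ∀ i : Fin N, Integrable fun x =>
      w x * fderiv ℝ (fun x => φ x i) x (EuclideanSpace.single i 1) := by
    intro i
    refine Integrable.bdd_mul (c := M) ?_ hw.aestronglyMeasurable (ae_of_all _ hM)
    refine Continuous.integrable_of_hasCompactSupport ?_ ?_
    · exact ((hcoord i).continuous_fderiv (by norm_num)).clm_apply continuous_const
    · exact (hcs i).fderiv_apply (𝕜 := ℝ) _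
  have : ∫ x, w x * diverg φ x =
      ∑ i, ∫ x, w x * fderiv ℝ (fun x => φ x i) x (EuclideanSpace.single i 1) := by
    rw [← integral_finsetSum _ fun i _ => hIntg i]
    congr 1
    ext x
    rw [diverg, Finset.mul_sum]
    simp only [hfd]
  rw [this]
  refine Finset.sum_le_sum fun i _ => ?_
  refine scalar_bound w hw M hM K hK (C i) (hC i) _ (hfr i) _ (hcoord i) (hcs i)
    ((hsub i).trans hs) fun x => ?_
  exact (PiLp.norm_apply_le (φ x) i).trans (h1 x)

theorem FreqDQ.variation_lt_top (w : Euc N → ℝ) (hw : Measurable w) (M : ℝ)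
    (hM : ∀ x, |w x| ≤ M) (Ω' : Set (Euc N)) (hK : IsCompact (closure Ω'))
    (h : FreqDQ w (closure Ω')) : variation w Ω' < ⊤ := by
  obtain ⟨B, hB⟩ := FreqDQ.bound w hw M hM _ hK h
  refine lt_of_le_of_lt (iSup₂_le fun φ hφ => ?_) (ENNReal.ofReal_lt_top (r := B))
  refine ENNReal.ofReal_le_ofReal ?_
  rw [setIntegral_eq_integral_of_forall_compl_eq_zero]
  · exact hB φ hφ.1 hφ.2.1 (hφ.2.2.1.trans subset_closure) hφ.2.2.2
  · intro x hx
    rw [diverg_zero_of_notMem φ x fun h' => hx (hφ.2.2.1 h'), mul_zero]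

theorem FreqDQ.perimeter_lt_top (A : Set (Euc N)) (hA : MeasurableSet A)
    (Ω' : Set (Euc N)) (hK : IsCompact (closure Ω'))
    (h : FreqDQ (A.indicator fun _ => (1:ℝ)) (closure Ω')) : perimeter A Ω' < ⊤ := by
  obtain ⟨B, hB⟩ := FreqDQ.bound _ (measurable_const.indicator hA) 1 (fun x => by
    by_cases hx : x ∈ A <;> simp [hx]) _ hK h
  refine lt_of_le_of_lt (iSup₂_le fun φ hφ => ?_) (ENNReal.ofReal_lt_top (r := B))
  refine ENNReal.ofReal_le_ofReal ?_
  have := hB φ hφ.1 hφ.2.1 (hφ.2.2.1.trans subset_closure) hφ.2.2.2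
  refine le_trans (le_of_eq ?_) this
  rw [← integral_indicator hA]
  congr 1
  ext x
  by_cases hx : x ∈ A <;> simp [hx]

theorem vol_ball_ne_zero (x : Euc N) {ρ : ℝ} (hρ : 0 < ρ) : volume (ball x ρ) ≠ 0 :=
  (measure_ball_pos volume x hρ).ne'

theorem vol_ball_ne_top (x : Euc N) (ρ : ℝ) : volume (ball x ρ) ≠ ⊤ :=
  measure_ball_lt_top.ne

theorem density_zero_mono {A B : Set (Euc N)} {x : Euc N} (hA : HasDensity A x 0)
    {r : ℝ} (hr : 0 < r) (hBA : B ∩ ball x r ⊆ A) : HasDensity B x 0 := by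
  unfold HasDensity at *
  rw [ENNReal.ofReal_zero] at *
  refine tendsto_of_tendsto_of_tendsto_of_le_of_le' tendsto_const_nhds hA
    (Eventually.of_forall fun _ => zero_le) ?_
  have : Ioo (0:ℝ) r ∈ 𝓝[>] (0:ℝ) := Ioo_mem_nhdsGT hr
  filter_upwards [this] with ρ hρ
  refine ENNReal.div_le_div_right (measure_mono ?_) _
  intro y hy
  exact ⟨hBA ⟨hy.1, ball_subset_ball hρ.2.le hy.2⟩, hy.2⟩

theorem density_congr {A B : Set (Euc N)} (h : A =ᵐ[volume] B) {x : Euc N} {t : ℝ}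
    (hA : HasDensity A x t) : HasDensity B x t := by
  unfold HasDensity at *
  refine hA.congr fun ρ => ?_
  rw [measure_congr (h.inter (ae_eq_refl (ball x ρ)))]

theorem density_one_of_compl {A : Set (Euc N)} (hA : NullMeasurableSet A volume) {x : Euc N}
    (h : HasDensity Aᶜ x 0) : HasDensity A x 1 := by
  unfold HasDensity at *
  rw [ENNReal.ofReal_zero] at h
  rw [ENNReal.ofReal_one]
  have h2 := ENNReal.Tendsto.sub (tendsto_const_nhds (x := (1:ℝ≥0∞)) (f := 𝓝[>] (0:ℝ))) h
    (Or.inl ENNReal.one_ne_top)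
  rw [tsub_zero] at h2
  refine h2.congr' ?_
  filter_upwards [self_mem_nhdsWithin] with ρ hρ
  have h0 := vol_ball_ne_zero x hρ
  have ht := vol_ball_ne_top x ρ
  symm
  refine ENNReal.eq_sub_of_add_eq ?_ ?_
  · exact (ENNReal.div_lt_top (measure_ne_top_of_subset inter_subset_right ht) h0).ne
  · rw [← ENNReal.add_div, inter_comm A, inter_comm Aᶜ, ← sdiff_eq, measure_inter_add_sdiff₀ _ hA,
      ENNReal.div_self h0 ht]

theorem density_compl_of_one {A : Set (Euc N)} (hA : NullMeasurableSet A volume) {x : Euc N}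
    (h : HasDensity A x 1) : HasDensity Aᶜ x 0 := by
  unfold HasDensity at *
  rw [ENNReal.ofReal_one] at h
  rw [ENNReal.ofReal_zero]
  have h2 := ENNReal.Tendsto.sub (tendsto_const_nhds (x := (1:ℝ≥0∞)) (f := 𝓝[>] (0:ℝ))) h
    (Or.inl ENNReal.one_ne_top)
  rw [tsub_self] at h2
  refine h2.congr' ?_
  filter_upwards [self_mem_nhdsWithin] with ρ hρ
  have h0 := vol_ball_ne_zero x hρ
  have ht := vol_ball_ne_top x ρ
  symm
  refine ENNReal.eq_sub_of_add_eq ?_ ?_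
  · exact (ENNReal.div_lt_top (measure_ne_top_of_subset inter_subset_right ht) h0).ne
  · rw [← ENNReal.add_div, inter_comm A, inter_comm Aᶜ, ← sdiff_eq, add_comm,
      measure_inter_add_sdiff₀ _ hA, ENNReal.div_self h0 ht]

theorem density_lt_of_top {u : Euc N → ℝ} {Ω : Set (Euc N)} {x : Euc N}
    (h : approxLower u Ω x = ⊤) (r : ℝ) : HasDensity {y | y ∈ Ω ∧ u y < r} x 0 := by
  unfold approxLower at h
  rw [sSup_eq_top] at h
  obtain ⟨t, ⟨s, rfl, hs⟩, hlt⟩ := h r (EReal.coe_lt_top r)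
  refine density_zero_mono hs one_pos ?_
  rintro y ⟨⟨h1, h2⟩, _⟩
  exact ⟨h1, h2.trans (EReal.coe_lt_coe_iff.1 hlt)⟩

theorem density_gt_of_bot {u : Euc N → ℝ} {Ω : Set (Euc N)} {x : Euc N}
    (h : approxUpper u Ω x = ⊥) (r : ℝ) : HasDensity {y | y ∈ Ω ∧ r < u y} x 0 := by
  unfold approxUpper at h
  rw [sInf_eq_bot] at h
  obtain ⟨t, ⟨s, rfl, hs⟩, hlt⟩ := h r (EReal.bot_lt_coe r)
  refine density_zero_mono hs one_pos ?_
  rintro y ⟨⟨h1, h2⟩, _⟩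
  exact ⟨h1, (EReal.coe_lt_coe_iff.1 hlt).trans h2⟩

theorem density_abs_lt {u : Euc N → ℝ} {Ω : Set (Euc N)} {x : Euc N}
    (h : HasInfApproxLimit u Ω x) (r : ℝ) : HasDensity {y | y ∈ Ω ∧ |u y| < r} x 0 := by
  rcases h with h | h
  · refine density_zero_mono (density_lt_of_top h.2 r) one_pos ?_
    rintro y ⟨⟨h1, h2⟩, _⟩
    exact ⟨h1, (abs_lt.1 h2).2⟩
  · refine density_zero_mono (density_gt_of_bot h.1 (-r)) one_pos ?_
    rintro y ⟨⟨h1, h2⟩, _⟩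
    exact ⟨h1, (abs_lt.1 h2).1⟩

theorem infLimit_of_density {u : Euc N → ℝ} (hu : Measurable u) {Ω : Set (Euc N)} (hΩ : IsOpen Ω)
    {x : Euc N} (hx : x ∈ Ω)
    (h : ∀ r : ℝ, HasDensity {y | y ∈ Ω ∧ u y < r} x 0) : HasInfApproxLimit u Ω x := by
  refine Or.inl ⟨?_, ?_⟩
  · unfold approxUpper
    rw [sInf_eq_top]
    rintro t ⟨s, rfl, hs⟩
    exfalso
    have hm : MeasurableSet {y | y ∈ Ω ∧ s < u y} :=
      hΩ.measurableSet.inter (measurableSet_lt measurable_const hu)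
    obtain ⟨r, hr, hball⟩ := Metric.isOpen_iff.1 hΩ x hx
    have h1 : HasDensity {y | y ∈ Ω ∧ s < u y}ᶜ x 0 := by
      refine density_zero_mono (h (s+1)) hr ?_
      rintro y ⟨h1, h2⟩
      refine ⟨hball h2, ?_⟩
      by_contra h3
      exact h1 ⟨hball h2, by linarith⟩
    have h2 := density_one_of_compl hm.nullMeasurableSet h1
    have := tendsto_nhds_unique hs h2
    simp at this
  · unfold approxLower
    rw [sSup_eq_top]
    intro b hb
    obtain ⟨r, hr1, -⟩ := EReal.lt_iff_exists_real_btwn.1 hb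
    exact ⟨r, ⟨r, rfl, h r⟩, hr1⟩

theorem density_zero_union {A B : Set (Euc N)} {x : Euc N} (hA : HasDensity A x 0)
    (hB : HasDensity B x 0) : HasDensity (A ∪ B) x 0 := by
  unfold HasDensity at *
  rw [ENNReal.ofReal_zero] at *
  have h := hA.add hB
  rw [add_zero] at h
  refine tendsto_of_tendsto_of_tendsto_of_le_of_le tendsto_const_nhds h
    (fun _ => zero_le) fun ρ => ?_
  simp only
  rw [← ENNReal.add_div, union_inter_distrib_right]
  exact ENNReal.div_le_div_right (measure_union_le _ _) _

theorem density_zero_exists {A : ℕ → Set (Euc N)} {x : Euc N} (hA : ∀ k, HasDensity (A k) x 0)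
    (n : ℕ) : HasDensity {y | ∃ k < n, y ∈ A k} x 0 := by
  induction n with
  | zero => simp [HasDensity]
  | succ n ih =>
    refine density_zero_mono (density_zero_union ih (hA n)) one_pos ?_
    rintro y ⟨⟨k, hk, hy⟩, _⟩
    rcases Nat.lt_succ_iff_lt_or_eq.1 hk with h | h
    · exact Or.inl ⟨k, h, hy⟩
    · exact Or.inr (h ▸ hy)

theorem exists_open_btw (Ω K : Set (Euc N)) (hΩ : IsOpen Ω) (hK : IsCompact K) (hKΩ : K ⊆ Ω) :
    ∃ V, IsOpen V ∧ K ⊆ V ∧ closure V ⊆ Ω ∧ IsCompact (closure V) :=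
  exists_open_between_and_isCompact_closure hK hΩ hKΩ

theorem dq_indicator (A Ω : Set (Euc N)) (hA : MeasurableSet A) (hΩ : IsOpen Ω)
    (hP : HasLocFinPerimeter A Ω) (K : Set (Euc N)) (hK : IsCompact K) (hKΩ : K ⊆ Ω) (i : Fin N) :
    ∃ C : ℝ≥0∞, C ≠ ⊤ ∧ ∃ δ > 0, ∀ t, 0 < t → t < δ →
      ∫⁻ x in K, ‖A.indicator (fun _ => (1:ℝ)) (x + t • EuclideanSpace.single i (1:ℝ)) -
        A.indicator (fun _ => (1:ℝ)) x‖ₑ ≤ C * ENNReal.ofReal t := by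
  obtain ⟨V, hV, hKV, hVΩ, hVc⟩ := exists_open_btw Ω K hΩ hK hKΩ
  have hp := hP V hV hVc hVΩ
  have hv : variation (A.indicator fun _ => (1:ℝ)) V ≤ perimeter A V := by
    refine iSup₂_mono fun φ hφ => ENNReal.ofReal_le_ofReal (le_of_eq ?_)
    rw [setIntegral_eq_integral_of_forall_compl_eq_zero, ← integral_indicator hA]
    · congr 1
      ext x
      by_cases hx : x ∈ A <;> simp [hx]
    · intro x hx
      rw [diverg_zero_of_notMem φ x fun h' => hx (hφ.2.2.1 h'), mul_zero]
  refine ⟨_, (hv.trans_lt hp).ne, ?_⟩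
  exact dq_of_variation _ (measurable_const.indicator hA) 1 (fun x => by
    by_cases hx : x ∈ A <;> simp [hx]) V K hV hK hKV i

theorem backward_aux (Ω : Set (Euc N)) (hΩ : IsOpen Ω) (C : Set (Euc N)) (hC : C ⊆ Ω)
    (A : ℕ → Set (Euc N)) (hA : ∀ k, MeasurableSet (A k))
    (hP : ∀ k, HasLocFinPerimeter (A k) Ω) (hemp : ∀ x, ∃ k, x ∉ A k)
    (hd : ∀ x ∈ C, ∀ k, HasDensity (A k) x 1) : GBVPolar C Ω := by
  classical
  set f : Euc N → ℕ := fun x => Nat.find (hemp x) with hf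
  have hfm : Measurable f := measurable_find hemp fun k => (hA k).compl
  have hum : Measurable fun x => (f x : ℝ) := (measurable_from_top (f := fun n : ℕ => (n:ℝ))).comp hfm
  refine ⟨fun x => (f x : ℝ), ⟨hum.aemeasurable, ?_⟩, ?_⟩
  · intro m hm Ω' hΩ' hc hcΩ
    set W : Euc N → ℝ := fun x => max (-m) (min (f x : ℝ) m) with hW
    have hWm : Measurable W := measurable_const.max (hum.min measurable_const)
    have hW0 : ∀ x, 0 ≤ W x := fun x => le_max_of_le_right (le_min (Nat.cast_nonneg _) hm.le)
    have hWle : ∀ x, W x ≤ m := fun x => max_le (by linarith) (min_le_right _ _)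
    have hWb : ∀ x, |W x| ≤ m := fun x => by rw [abs_of_nonneg (hW0 x)]; exact hWle x
    have hfin : volume Ω' ≠ ⊤ :=
      ((measure_mono subset_closure).trans_lt hc.measure_lt_top).ne
    refine ⟨Measure.integrableOn_of_bounded (M := m) hfin hWm.aestronglyMeasurable
      (ae_of_all _ hWb), ?_⟩
    refine FreqDQ.variation_lt_top W hWm m hWb Ω' hc ?_
    intro i
    set e : Euc N := EuclideanSpace.single i (1:ℝ)
    set n := ⌈m⌉₊ with hn
    let I : ℕ → Euc N → ℝ := fun k => (A k).indicator fun _ => (1:ℝ)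
    have hIm : ∀ k, Measurable (I k) := fun k => measurable_const.indicator (hA k)
    have hpt : ∀ x y, |W y - W x| ≤ m * ∑ k ∈ Finset.range n, |I k y - I k x| := by
      intro x y
      by_cases h : ∀ k < n, (x ∈ A k ↔ y ∈ A k)
      · have hWeq : W y = W x := by
          have key : ∀ a b : Euc N, (∀ k < n, (a ∈ A k ↔ b ∈ A k)) → f a < n → f b ≤ f a := by
            intro a b hab hlt
            exact Nat.find_min' _ fun hb => Nat.find_spec (hemp a) ((hab _ hlt).2 hb)
          have hbig : ∀ a, n ≤ f a → W a = m := by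
            intro a ha
            have : m ≤ (f a : ℝ) := (Nat.le_ceil m).trans (by exact_mod_cast ha)
            simp only [hW]
            rw [min_eq_right this, max_eq_right (by linarith)]
          by_cases hx : f x < n
          · have h1 := key x y h hx
            have h2 := key y x (fun k hk => (h k hk).symm) (h1.trans_lt hx)
            simp only [hW, le_antisymm h1 h2]
          · by_cases hy : f y < n
            · have h1 := key y x (fun k hk => (h k hk).symm) hy
              omega
            · rw [hbig x (not_lt.1 hx), hbig y (not_lt.1 hy)]
        rw [hWeq, sub_self, abs_zero]
        exact mul_nonneg hm.le (Finset.sum_nonneg fun _ _ => abs_nonneg _)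
      · push Not at h
        obtain ⟨k, hk, hne⟩ := h
        have h1 : |I k y - I k x| = 1 := by
          simp only [I]
          rcases hne with ⟨ha, hb⟩ | ⟨ha, hb⟩ <;> simp [ha, hb]
        have h2 : (1:ℝ) ≤ ∑ k ∈ Finset.range n, |I k y - I k x| := by
          rw [← h1]
          exact Finset.single_le_sum (f := fun k => |I k y - I k x|)
            (fun _ _ => abs_nonneg _) (Finset.mem_range.2 hk)
        have h3 : |W y - W x| ≤ m := by
          rw [abs_le]; constructor <;> linarith [hW0 x, hW0 y, hWle x, hWle y]
        nlinarith
    have hpe : ∀ x y, ‖W y - W x‖ₑ ≤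
        ENNReal.ofReal m * ∑ k ∈ Finset.range n, ‖I k y - I k x‖ₑ := by
      intro x y
      have := ENNReal.ofReal_le_ofReal (hpt x y)
      rw [ENNReal.ofReal_mul hm.le, ENNReal.ofReal_sum_of_nonneg fun _ _ => abs_nonneg _] at this
      simpa only [Real.enorm_eq_ofReal_abs] using this
    choose c hcne δ hδ hb using fun k => dq_indicator (A k) Ω (hA k) hΩ (hP k) (closure Ω') hc hcΩ i
    refine ⟨ENNReal.ofReal m * ∑ k ∈ Finset.range n, c k,
      ENNReal.mul_ne_top ENNReal.ofReal_ne_top (ENNReal.sum_ne_top.2 fun k _ => hcne k), ?_⟩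
    have hev : ∀ᶠ j : ℕ in atTop, ∀ k ∈ Finset.range n, 1 / ((j:ℝ) + 1) < δ k := by
      rw [Filter.eventually_all_finset]
      intro k _
      exact (tendsto_one_div_add_atTop_nhds_zero_nat (𝕜 := ℝ)).eventually_lt_const (hδ k)
    refine (hev.mono fun j hj => ?_).frequently
    have hjp : (0:ℝ) < 1 / ((j:ℝ) + 1) := by positivity
    have hmeas : ∀ k, Measurable fun x => ‖I k (x + (1 / ((j:ℝ) + 1)) • e) - I k x‖ₑ := fun k =>
      (((hIm k).comp (measurable_id.add_const _)).sub (hIm k)).enorm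
    calc _ ≤ ∫⁻ x in closure Ω', ENNReal.ofReal m * ∑ k ∈ Finset.range n,
            ‖I k (x + (1 / ((j:ℝ) + 1)) • e) - I k x‖ₑ := lintegral_mono fun x => hpe _ _
      _ = ENNReal.ofReal m * ∑ k ∈ Finset.range n, ∫⁻ x in closure Ω',
            ‖I k (x + (1 / ((j:ℝ) + 1)) • e) - I k x‖ₑ := by
          rw [lintegral_const_mul _ (Finset.measurable_fun_sum _ fun k _ => hmeas k),
            lintegral_finsetSum _ fun k _ => hmeas k]
      _ ≤ ENNReal.ofReal m * ∑ k ∈ Finset.range n, c k * ENNReal.ofReal (1 / ((j:ℝ) + 1)) := by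
          gcongr with k hk
          exact hb k _ hjp (hj k hk)
      _ = _ := by rw [← Finset.sum_mul, mul_assoc]
  · intro x hx
    refine ⟨hC hx, infLimit_of_density hum hΩ (hC hx) fun r => ?_⟩
    have h1 := density_zero_exists
      (fun k => density_compl_of_one (hA k).nullMeasurableSet (hd x hx k)) (⌈r⌉₊)
    refine density_zero_mono h1 one_pos ?_
    rintro y ⟨⟨_, hy⟩, _⟩
    refine ⟨f y, ?_, Nat.find_spec (hemp y)⟩
    exact Nat.lt_ceil.2 hy

theorem backward (Ω : Set (Euc N)) (hΩ : IsOpen Ω) (C : Set (Euc N)) (hC : C ⊆ Ω)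
    (A : ℕ → Set (Euc N)) (hA : ∀ k, NullMeasurableSet (A k) volume)
    (hP : ∀ k, HasLocFinPerimeter (A k) Ω)
    (hv : Tendsto (fun k => volume (A k)) atTop (𝓝 0))
    (hd : ∀ x ∈ C, ∀ k, HasDensity (A k) x 1) : GBVPolar C Ω := by
  choose B hBs hBm hBe using fun k => (hA k).exists_measurable_subset_ae_eq
  set Z := ⋂ k, B k with hZ
  have hZm : MeasurableSet Z := MeasurableSet.iInter hBm
  have hZ0 : volume Z = 0 := by
    refine le_antisymm (ge_of_tendsto' hv fun k => ?_) zero_le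
    exact measure_mono ((iInter_subset _ k).trans (hBs k))
  have hE : ∀ k, A k =ᵐ[volume] (B k \ Z : Set (Euc N)) := fun k =>
    (hBe k).symm.trans (sdiff_null_ae_eq_self hZ0).symm
  refine backward_aux Ω hΩ C hC (fun k => B k \ Z) (fun k => (hBm k).diff hZm) ?_ ?_ ?_
  · intro k Ω' h1 h2 h3
    have : perimeter (B k \ Z) Ω' = perimeter (A k) Ω' := by
      unfold perimeter
      simp only [setIntegral_congr_set (hE k)]
    rw [this]
    exact hP k Ω' h1 h2 h3
  · intro x
    by_contra h
    push Not at h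
    exact (h 0).2 (mem_iInter.2 fun k => (h k).1)
  · intro x hx k
    exact density_congr (hE k) (hd x hx k)

theorem exists_exhaustion (Ω : Set (Euc N)) (hΩ : IsOpen Ω) :
    ∃ K : ℕ → Set (Euc N), (∀ j, IsCompact (K j)) ∧ Monotone K ∧ (∀ j, K j ⊆ Ω) ∧ K 0 = ∅ ∧
      ∀ x ∈ Ω, ∃ j, x ∈ interior (K j) := by
  let K₀ : ℕ → Set (Euc N) := fun j =>
    closedBall 0 (j:ℝ) ∩ (thickening (1 / ((j:ℝ) + 1)) Ωᶜ)ᶜ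
  have hmono : Monotone K₀ := by
    intro a b hab
    have hab' : (a:ℝ) ≤ b := by exact_mod_cast hab
    refine inter_subset_inter (closedBall_subset_closedBall hab') (compl_subset_compl.2 ?_)
    refine thickening_mono ?_ _
    gcongr
  have hcpt : ∀ j, IsCompact (K₀ j) := fun j =>
    (isCompact_closedBall _ _).inter_right isOpen_thickening.isClosed_compl
  have hsub : ∀ j, K₀ j ⊆ Ω := fun j x hx => by
    by_contra h
    exact hx.2 (self_subset_thickening (by positivity) _ h)
  have hIntg : ∀ x ∈ Ω, ∃ j, x ∈ interior (K₀ j) := by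
    intro x hx
    obtain ⟨r, hr, hball⟩ := Metric.isOpen_iff.1 hΩ x hx
    obtain ⟨j1, hj1⟩ := exists_nat_ge (‖x‖ + r)
    obtain ⟨j2, hj2⟩ := exists_nat_one_div_lt (half_pos hr)
    refine ⟨max j1 j2, mem_interior.2 ⟨ball x (r/2), ?_, isOpen_ball, mem_ball_self (half_pos hr)⟩⟩
    intro y hy
    have h2 : 1 / (((max j1 j2 : ℕ) : ℝ) + 1) ≤ 1 / ((j2:ℝ) + 1) := by
      have : (j2:ℝ) ≤ ((max j1 j2 : ℕ) : ℝ) := by exact_mod_cast le_max_right _ _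
      gcongr
    have h1 : (j1:ℝ) ≤ ((max j1 j2 : ℕ) : ℝ) := by exact_mod_cast le_max_left _ _
    rw [mem_ball] at hy
    refine ⟨?_, fun hth => ?_⟩
    · rw [mem_closedBall, dist_zero_right]
      have : ‖y‖ ≤ ‖x‖ + dist y x := by
        rw [dist_eq_norm]
        calc ‖y‖ = ‖x + (y - x)‖ := by congr 1; abel
          _ ≤ _ := norm_add_le _ _
      linarith
    · obtain ⟨z, hz, hyz⟩ := mem_thickening_iff.1 hth
      apply hz
      apply hball
      rw [mem_ball]
      have := dist_triangle_left z x y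
      linarith
  refine ⟨fun j => Nat.casesOn j ∅ K₀, ?_, ?_, ?_, rfl, ?_⟩
  · rintro (_ | j)
    · exact isCompact_empty
    · exact hcpt j
  · refine monotone_nat_of_le_succ ?_
    rintro (_ | j)
    · exact empty_subset _
    · exact hmono (Nat.le_succ j)
  · rintro (_ | j)
    · exact empty_subset _
    · exact hsub j
  · intro x hx
    obtain ⟨j, hj⟩ := hIntg x hx
    exact ⟨j + 1, hj⟩

theorem exists_threshold (v : Euc N → ℝ) (hv : Measurable v) (K : Set (Euc N)) (hK : IsCompact K)
    (ε : ℝ≥0∞) (hε : 0 < ε) : ∃ T : ℝ, 0 < T ∧ volume (K ∩ {x | T < v x}) ≤ ε := by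
  have hT : Tendsto (fun n : ℕ => volume (K ∩ {x | (n:ℝ) < v x})) atTop
      (𝓝 (volume (⋂ n : ℕ, K ∩ {x | (n:ℝ) < v x}))) := by
    refine tendsto_measure_iInter_atTop ?_ ?_ ?_
    · exact fun n => (hK.measurableSet.inter
        (measurableSet_lt measurable_const hv)).nullMeasurableSet
    · intro a b hab x hx
      have : (a:ℝ) ≤ b := by exact_mod_cast hab
      exact ⟨hx.1, this.trans_lt hx.2⟩
    · exact ⟨0, measure_ne_top_of_subset inter_subset_left hK.measure_lt_top.ne⟩
  have hem : (⋂ n : ℕ, K ∩ {x | (n:ℝ) < v x}) = ∅ := by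
    refine eq_empty_of_forall_notMem fun x hx => ?_
    obtain ⟨n, hn⟩ := exists_nat_ge (v x)
    have := (mem_iInter.1 hx n).2
    exact absurd this (not_lt.2 hn)
  rw [hem, measure_empty] at hT
  obtain ⟨n, hn, hn1⟩ := ((hT.eventually_lt_const hε).and (eventually_ge_atTop 1)).exists
  exact ⟨n, by exact_mod_cast hn1, hn.le⟩

theorem exists_eta (Ω : Set (Euc N)) (hΩ : IsOpen Ω) (v : Euc N → ℝ) (hv : Measurable v)
    (hv0 : ∀ x, 0 ≤ v x) (ε : ℝ≥0∞) (hε : ε ≠ 0) :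
    ∃ η : Euc N → ℝ, (∀ x y, |η x - η y| ≤ dist x y) ∧ (∀ x ∈ Ω, 0 < η x) ∧
      volume {x | x ∈ Ω ∧ 1 < η x * v x} ≤ ε := by
  rcases Nat.eq_zero_or_pos N with hN | hN
  · subst hN
    refine ⟨fun _ => 1 / (1 + v 0), fun x y => by simp, fun x _ => ?_, ?_⟩
    · have := hv0 0
      positivity
    · have : {x | x ∈ Ω ∧ 1 < 1 / (1 + v 0) * v x} = ∅ := by
        refine eq_empty_of_forall_notMem ?_
        rintro x ⟨_, hx⟩
        rw [Subsingleton.elim x 0, div_mul_eq_mul_div, one_mul,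
          one_lt_div (by linarith [hv0 0])] at hx
        linarith
      rw [this]; simp
  have : Nonempty (Fin N) := ⟨⟨0, hN⟩⟩
  obtain ⟨K, hKc, hKm, hKs, hK0, hKi⟩ := exists_exhaustion Ω hΩ
  obtain ⟨ε', hε'0, hε's⟩ := ENNReal.exists_pos_sum_of_countable' hε ℕ
  choose T hT hTv using fun j => exists_threshold v hv (K (j+1)) (hKc (j+1)) (ε' j) (hε'0 j)
  let c : ℕ → ℝ := fun j => 1 / T j
  have hc : ∀ j, 0 < c j := fun j => one_div_pos.2 (hT j)
  have hbdd : ∀ x, BddBelow (range fun j => c j + infDist x (K j)ᶜ) := fun x =>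
    ⟨0, by rintro _ ⟨j, rfl⟩; exact add_nonneg (hc j).le infDist_nonneg⟩
  let η : Euc N → ℝ := fun x => ⨅ j, (c j + infDist x (K j)ᶜ)
  have hηle : ∀ x j, η x ≤ c j + infDist x (K j)ᶜ := fun x j => ciInf_le (hbdd x) j
  have hlip : ∀ x y, η x ≤ η y + dist x y := by
    intro x y
    rw [← sub_le_iff_le_add]
    refine le_ciInf fun j => ?_
    have h1 := hηle x j
    have h2 := infDist_le_infDist_add_dist (s := (K j)ᶜ) (x := x) (y := y)
    linarith
  have hne : ∀ j, (K j)ᶜ.Nonempty := by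
    intro j
    by_contra h
    rw [not_nonempty_iff_eq_empty, compl_empty_iff] at h
    exact noncompact_univ (Euc N) (h ▸ hKc j)
  refine ⟨η, ?_, ?_, ?_⟩
  · intro x y
    rw [abs_sub_le_iff]
    have h1 := hlip x y
    have h2 := hlip y x
    rw [dist_comm] at h2
    constructor <;> linarith
  · intro x hx
    obtain ⟨j0, hj0⟩ := hKi x hx
    obtain ⟨r, hr, hball⟩ := Metric.isOpen_iff.1 isOpen_interior x hj0
    have hmin : ∀ n : ℕ, ∃ a > 0, ∀ j < n, a ≤ c j := by
      intro n
      induction n with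
      | zero => exact ⟨1, one_pos, fun j hj => absurd hj (Nat.not_lt_zero _)⟩
      | succ n ih =>
        obtain ⟨a, ha, hj⟩ := ih
        refine ⟨min a (c n), lt_min ha (hc n), fun j hjn => ?_⟩
        rcases Nat.lt_succ_iff_lt_or_eq.1 hjn with h | h
        · exact (min_le_left _ _).trans (hj j h)
        · exact h ▸ min_le_right _ _
    obtain ⟨a, ha, haj⟩ := hmin j0
    refine lt_of_lt_of_le (lt_min ha hr) (le_ciInf fun j => ?_)
    rcases lt_or_ge j j0 with h | h
    · exact (min_le_left _ _).trans ((haj j h).trans (le_add_of_nonneg_right infDist_nonneg))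
    · refine (min_le_right _ _).trans ?_
      have : r ≤ infDist x (K j)ᶜ := by
        refine (le_infDist (hne j)).2 fun y hy => ?_
        by_contra hlt
        apply hy
        apply hKm h
        apply interior_subset
        apply hball
        rw [mem_ball, dist_comm]
        exact not_le.1 hlt
      linarith [hc j]
  · have hcov : {x | x ∈ Ω ∧ 1 < η x * v x} ⊆ ⋃ j, (K (j+1) ∩ {x | T j < v x}) := by
      classical
      rintro x ⟨hx, h1⟩
      have hex : ∃ j, x ∈ K j := (hKi x hx).imp fun j hj => interior_subset hj
      have hspec := Nat.find_spec hex
      have hmn := fun j => Nat.find_min hex (m := j)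
      rcases hj : Nat.find hex with _ | j
      · rw [hj, hK0] at hspec
        exact absurd hspec (notMem_empty x)
      · rw [hj] at hspec
        have hnot := hmn j (by omega)
        refine mem_iUnion.2 ⟨j, hspec, ?_⟩
        have h2 := hηle x j
        rw [infDist_zero_of_mem (show x ∈ (K j)ᶜ from hnot), add_zero] at h2
        have h3 : 1 < c j * v x := h1.trans_le (mul_le_mul_of_nonneg_right h2 (hv0 x))
        simp only [c, div_mul_eq_mul_div, one_mul] at h3
        exact (one_lt_div (hT j)).1 h3
    calc _ ≤ volume (⋃ j, (K (j+1) ∩ {x | T j < v x})) := measure_mono hcov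
      _ ≤ ∑' j, volume (K (j+1) ∩ {x | T j < v x}) := measure_iUnion_le _
      _ ≤ ∑' j, ε' j := ENNReal.tsum_le_tsum hTv
      _ ≤ ε := hε's.le

theorem coarea_pt (a b : ℝ) :
    ∫⁻ s : ℝ, ‖(if s < a then (1:ℝ) else 0) - (if s < b then (1:ℝ) else 0)‖ₑ = ‖a - b‖ₑ := by
  have h : (fun s : ℝ => ‖(if s < a then (1:ℝ) else 0) - (if s < b then (1:ℝ) else 0)‖ₑ) =
      (Ico (min a b) (max a b)).indicator fun _ => (1:ℝ≥0∞) := by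
    ext s
    by_cases h1 : s < a <;> by_cases h2 : s < b
    · rw [indicator_of_notMem]
      · simp [h1, h2]
      · rintro ⟨h3, -⟩
        exact absurd h3 (not_le.2 (lt_min h1 h2))
    · rw [indicator_of_mem]
      · simp [h1, h2]
      · exact ⟨(min_le_right _ _).trans (not_lt.1 h2), lt_max_of_lt_left h1⟩
    · rw [indicator_of_mem]
      · simp [h1, h2]
      · exact ⟨(min_le_left _ _).trans (not_lt.1 h1), lt_max_of_lt_right h2⟩
    · rw [indicator_of_notMem]
      · simp [h1, h2]
      · rintro ⟨-, h3⟩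
        exact absurd h3 (not_lt.2 (max_le (not_lt.1 h1) (not_lt.1 h2)))
  rw [h, lintegral_indicator_const measurableSet_Ico, one_mul, Real.volume_Ico,
    max_sub_min_eq_abs', Real.enorm_eq_ofReal_abs]

theorem coarea_ae (G : Euc N → ℝ) (hG : Measurable G) (K : Set (Euc N)) (e : Euc N)
    (h : ∃ C : ℝ≥0∞, C ≠ ⊤ ∧ ∃ δ > 0, ∀ t, 0 < t → t < δ →
      ∫⁻ x in K, ‖G (x + t • e) - G x‖ₑ ≤ C * ENNReal.ofReal t) :
    ∀ᵐ s : ℝ, ∃ C : ℝ≥0∞, C ≠ ⊤ ∧ ∃ᶠ n : ℕ in atTop,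
      ∫⁻ x in K, ‖{x | s < G x}.indicator (fun _ => (1:ℝ)) (x + (1 / ((n:ℝ) + 1)) • e) -
        {x | s < G x}.indicator (fun _ => (1:ℝ)) x‖ₑ ≤ C * ENNReal.ofReal (1 / ((n:ℝ) + 1)) := by
  obtain ⟨C, hC, δ, hδ, hb⟩ := h
  let I : ℝ → Euc N → ℝ := fun s x => if s < G x then 1 else 0
  have hI : ∀ s x, {x | s < G x}.indicator (fun _ => (1:ℝ)) x = I s x := fun s x => by
    simp only [indicator_apply, mem_setOf_eq, I]
  simp only [hI]
  let r : ℕ → ℝ := fun n => 1 / ((n:ℝ) + 1)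
  have hr : ∀ n, 0 < r n := fun n => by positivity
  let q : ℕ → ℝ → Euc N → ℝ≥0∞ := fun n s x => ‖I s (x + r n • e) - I s x‖ₑ
  have hIm : Measurable (fun p : ℝ × Euc N => I p.1 p.2) :=
    Measurable.ite (measurableSet_lt measurable_fst (hG.comp measurable_snd)) measurable_const
      measurable_const
  have hqm : ∀ n, Measurable (fun p : ℝ × Euc N => q n p.1 p.2) := fun n =>
    ((hIm.comp (measurable_fst.prodMk (measurable_snd.add_const (r n • e)))).sub hIm).enorm
  let F : ℕ → ℝ → ℝ≥0∞ := fun n s => (∫⁻ x in K, q n s x) / ENNReal.ofReal (r n)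
  have hFm : ∀ n, Measurable (F n) := fun n =>
    (Measurable.lintegral_prod_right' (ν := volume.restrict K) (hqm n)).div_const _
  have hFi : ∀ n, r n < δ → ∫⁻ s, F n s ≤ C := by
    intro n hn
    have h1 : ∫⁻ s, F n s = (∫⁻ s, ∫⁻ x in K, q n s x) / ENNReal.ofReal (r n) := by
      simp only [F, div_eq_mul_inv]
      rw [lintegral_mul_const]
      exact Measurable.lintegral_prod_right' (ν := volume.restrict K) (hqm n)
    rw [h1]
    have h2 : ∫⁻ s, ∫⁻ x in K, q n s x = ∫⁻ x in K, ∫⁻ s, q n s x :=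
      lintegral_lintegral_swap (hqm n).aemeasurable
    have h3 : ∀ x, ∫⁻ s, q n s x = ‖G (x + r n • e) - G x‖ₑ := fun x => coarea_pt _ _
    rw [h2]
    simp only [h3]
    exact ENNReal.div_le_of_le_mul (hb (r n) (hr n) hn)
  have hlim : ∫⁻ s, liminf (fun n => F n s) atTop ≤ C := by
    refine (lintegral_liminf_le hFm).trans ?_
    have hev : ∀ᶠ n in atTop, ∫⁻ s, F n s ≤ C := by
      have := (tendsto_one_div_add_atTop_nhds_zero_nat (𝕜 := ℝ)).eventually_lt_const hδ
      exact this.mono fun n hn => hFi n hn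
    exact liminf_le_of_frequently_le' hev.frequently
  have hae := ae_lt_top (Measurable.liminf hFm) (hlim.trans_lt hC.lt_top).ne
  filter_upwards [hae] with s hs
  obtain ⟨D, hD1, hD2⟩ := exists_between hs
  refine ⟨D, hD2.ne, (frequently_lt_of_liminf_lt (by isBoundedDefault) hD1).mono fun n hn => ?_⟩
  have h0 : ENNReal.ofReal (r n) ≠ 0 := by simpa using hr n
  exact (ENNReal.div_le_iff h0 ENNReal.ofReal_ne_top).1 hn.le

def DQ (w : Euc N → ℝ) (Ω : Set (Euc N)) : Prop :=
  ∀ K : Set (Euc N), IsCompact K → K ⊆ Ω → ∀ i : Fin N,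
    ∃ C : ℝ≥0∞, C ≠ ⊤ ∧ ∃ δ > 0, ∀ t, 0 < t → t < δ →
      ∫⁻ x in K, ‖w (x + t • EuclideanSpace.single i (1:ℝ)) - w x‖ₑ ≤ C * ENNReal.ofReal t

theorem clamp_lip (a b : ℝ) : |max 0 (min a 1) - max 0 (min b 1)| ≤ |a - b| := by
  have h1 := abs_max_sub_max_le_abs (min a 1) (min b 1) 0
  rw [max_comm (min a 1), max_comm (min b 1)] at h1
  exact h1.trans ((abs_min_sub_min_le_max a 1 b 1).trans (by simp))

theorem abs_clamp (a m : ℝ) (hm : 0 < m) : |max (-m) (min a m)| = min |a| m := by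
  rcases le_total 0 a with h | h
  · rw [abs_of_nonneg h, max_eq_right, abs_of_nonneg (le_min h hm.le)]
    linarith [le_min h hm.le]
  · rw [min_eq_left (by linarith), abs_of_nonpos h, abs_of_nonpos (max_le (by linarith) h)]
    rcases le_total (-m) a with h2 | h2
    · rw [max_eq_right h2, min_eq_left (by linarith)]
    · rw [max_eq_left h2, min_eq_right (by linarith), neg_neg]

theorem dq_G (Ω : Set (Euc N)) (hΩ : IsOpen Ω) (u : Euc N → ℝ) (hu : Measurable u)
    (hDQ : ∀ m : ℝ, 0 < m → DQ (fun x => max (-m) (min (u x) m)) Ω)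
    (η : Euc N → ℝ) (hη : ∀ x y, |η x - η y| ≤ dist x y) (hpos : ∀ x ∈ Ω, 0 < η x) :
    DQ (Ω.indicator fun x => max 0 (min (η x * |u x| - 1) 1)) Ω := by
  intro K hK hKΩ i
  set e : Euc N := EuclideanSpace.single i (1:ℝ) with he
  have hen : ‖e‖ = 1 := by simp [he]
  rcases K.eq_empty_or_nonempty with rfl | hKne
  · exact ⟨0, by simp, 1, one_pos, fun t _ _ => by simp⟩
  obtain ⟨r, hr, hsub⟩ := hK.exists_cthickening_subset_open hΩ hKΩ
  set K' := cthickening r K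
  have hK' : IsCompact K' := hK.cthickening
  have hKK' : K ⊆ K' := self_subset_cthickening _
  have hηc : Continuous η := by
    have : LipschitzWith 1 η := LipschitzWith.of_dist_le_mul fun x y => by
      simpa [Real.dist_eq] using hη x y
    exact this.continuous
  obtain ⟨x0, hx0, hmin⟩ := hK'.exists_isMinOn (hKne.mono hKK') hηc.continuousOn
  obtain ⟨x1, hx1, hmax⟩ := hK'.exists_isMaxOn (hKne.mono hKK') hηc.continuousOn
  set c := η x0
  have hc : 0 < c := hpos _ (hsub hx0)
  set H := η x1
  have hH : 0 < H := hpos _ (hsub hx1)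
  set m := 2 / c with hm
  have hm0 : 0 < m := by positivity
  set p : Euc N → ℝ := fun x => max (-m) (min (u x) m) with hp
  have hpm : Measurable p := measurable_const.max (hu.min measurable_const)
  set G := Ω.indicator fun x => max 0 (min (η x * |u x| - 1) 1) with hG
  have hGp : ∀ x ∈ K', G x = max 0 (min (η x * |p x| - 1) 1) := by
    intro x hx
    rw [hG, indicator_of_mem (hsub hx), hp, abs_clamp _ _ hm0]
    rcases le_total (|u x|) m with h | h
    · rw [min_eq_left h]
    · rw [min_eq_right h]
      have h1 : c ≤ η x := hmin hx
      have h2 : 2 ≤ η x * m := by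
        calc 2 = c * m := by rw [hm]; field_simp
          _ ≤ _ := by gcongr
      have h3 : η x * m ≤ η x * |u x| := by
        have := hpos x (hsub hx)
        gcongr
      rw [min_eq_right (by linarith : 1 ≤ η x * |u x| - 1),
        min_eq_right (by linarith : 1 ≤ η x * m - 1)]
  have hpb : ∀ x, |p x| ≤ m := fun x => by rw [hp, abs_clamp _ _ hm0]; exact min_le_right _ _
  have hpt : ∀ x ∈ K', ∀ y ∈ K', |G y - G x| ≤ H * |p y - p x| + m * dist y x := by
    intro x hx y hy
    rw [hGp x hx, hGp y hy]
    refine (clamp_lip _ _).trans ?_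
    have e1 : η y * |p y| - 1 - (η x * |p x| - 1) =
        η y * (|p y| - |p x|) + (η y - η x) * |p x| := by ring
    rw [e1]
    refine (abs_add_le _ _).trans ?_
    rw [abs_mul, abs_mul, abs_abs]
    have h1 : |η y| ≤ H := by
      rw [abs_of_pos (hpos y (hsub hy))]; exact hmax hy
    have h2 := abs_abs_sub_abs_le_abs_sub (p y) (p x)
    have h3 := hη y x
    have h4 : |η y| * |(|p y| - |p x|)| ≤ H * |p y - p x| :=
      mul_le_mul h1 h2 (abs_nonneg _) hH.le
    have h5 : |η y - η x| * |p x| ≤ dist y x * m :=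
      mul_le_mul h3 (hpb x) (abs_nonneg _) dist_nonneg
    linarith
  obtain ⟨C, hC, δ, hδ, hb⟩ := hDQ m hm0 K hK hKΩ i
  refine ⟨ENNReal.ofReal H * C + ENNReal.ofReal m * volume K, ?_, min δ r, lt_min hδ hr, ?_⟩
  · exact ENNReal.add_ne_top.2 ⟨ENNReal.mul_ne_top ENNReal.ofReal_ne_top hC,
      ENNReal.mul_ne_top ENNReal.ofReal_ne_top hK.measure_lt_top.ne⟩
  intro t ht htδ
  have hdist : ∀ x : Euc N, dist (x + t • e) x = t := fun x => by
    rw [dist_eq_norm, add_sub_cancel_left, norm_smul, hen, mul_one, Real.norm_of_nonneg ht.le]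
  have hmeas : Measurable fun x => ‖p (x + t • e) - p x‖ₑ :=
    ((hpm.comp (measurable_id.add_const _)).sub hpm).enorm
  calc ∫⁻ x in K, ‖G (x + t • e) - G x‖ₑ
      ≤ ∫⁻ x in K, (ENNReal.ofReal H * ‖p (x + t • e) - p x‖ₑ +
          ENNReal.ofReal m * ENNReal.ofReal t) := by
        refine setLIntegral_mono' hK.measurableSet fun x hx => ?_
        have hy : x + t • e ∈ K' := by
          refine mem_cthickening_of_dist_le _ _ _ _ hx ?_
          rw [hdist]; exact (htδ.trans_le (min_le_right _ _)).le
        have := ENNReal.ofReal_le_ofReal (hpt x (hKK' hx) _ hy)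
        rw [hdist, ENNReal.ofReal_add (by positivity) (by positivity), ENNReal.ofReal_mul hH.le,
          ENNReal.ofReal_mul hm0.le] at this
        simpa only [Real.enorm_eq_ofReal_abs] using this
    _ = ENNReal.ofReal H * (∫⁻ x in K, ‖p (x + t • e) - p x‖ₑ) +
          ENNReal.ofReal m * ENNReal.ofReal t * volume K := by
        rw [lintegral_add_left (hmeas.const_mul _), lintegral_const_mul _ hmeas,
          setLIntegral_const]
    _ ≤ ENNReal.ofReal H * (C * ENNReal.ofReal t) +
          ENNReal.ofReal m * ENNReal.ofReal t * volume K := by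
        gcongr
        exact hb t ht (htδ.trans_le (min_le_left _ _))
    _ = _ := by ring

theorem forward_aux (Ω : Set (Euc N)) (hΩ : IsOpen Ω) (C : Set (Euc N)) (hC : C ⊆ Ω)
    (u : Euc N → ℝ) (hu : Measurable u)
    (hDQ : ∀ m : ℝ, 0 < m → DQ (fun x => max (-m) (min (u x) m)) Ω)
    (hd : ∀ x ∈ C, ∀ r : ℝ, HasDensity {y | y ∈ Ω ∧ |u y| < r} x 0)
    (ε : ℝ≥0∞) (hε : ε ≠ 0) :
    ∃ A : Set (Euc N), MeasurableSet A ∧ A ⊆ Ω ∧ HasLocFinPerimeter A Ω ∧ volume A ≤ ε ∧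
      ∀ x ∈ C, HasDensity A x 1 := by
  obtain ⟨η, hη, hpos, hvol⟩ := exists_eta Ω hΩ (fun x => |u x|) hu.abs (fun x => abs_nonneg _) ε hε
  have hηc : Continuous η := by
    have : LipschitzWith 1 η := LipschitzWith.of_dist_le_mul fun x y => by
      simpa [Real.dist_eq] using hη x y
    exact this.continuous
  set G := Ω.indicator fun x => max 0 (min (η x * |u x| - 1) 1) with hG
  have hGm : Measurable G :=
    (measurable_const.max (((hηc.measurable.mul hu.abs).sub_const 1).min
      measurable_const)).indicator hΩ.measurableSet
  have hGDQ : DQ G Ω := dq_G Ω hΩ u hu hDQ η hη hpos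
  obtain ⟨K, hKc, hKm, hKs, -, hKi⟩ := exists_exhaustion Ω hΩ
  have hae : ∀ᵐ s : ℝ, ∀ j : ℕ, FreqDQ ({x | s < G x}.indicator fun _ => (1:ℝ)) (K j) := by
    rw [ae_all_iff]
    intro j
    unfold FreqDQ
    rw [ae_all_iff]
    intro i
    exact coarea_ae G hGm (K j) _ (hGDQ (K j) (hKc j) (hKs j) i)
  obtain ⟨s, hs, hsj⟩ : ∃ s ∈ Ioo (0:ℝ) 1,
      ∀ j : ℕ, FreqDQ ({x | s < G x}.indicator fun _ => (1:ℝ)) (K j) := by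
    by_contra hcon
    push Not at hcon
    have : volume (Ioo (0:ℝ) 1) = 0 :=
      measure_mono_null (fun s hs => by
        obtain ⟨j, hj⟩ := hcon s hs
        exact fun h => hj (h j)) (ae_iff.1 hae)
    simp at this
  have hAm : MeasurableSet {x | s < G x} := measurableSet_lt measurable_const hGm
  have hAΩ : {x | s < G x} ⊆ Ω := by
    intro x hx
    by_contra h
    have : G x = 0 := indicator_of_notMem h _
    have h2 : s < G x := hx
    linarith [hs.1]
  refine ⟨{x | s < G x}, hAm, hAΩ, ?_, ?_, ?_⟩
  · intro Ω' hΩ' hc hcΩ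
    refine FreqDQ.perimeter_lt_top _ hAm Ω' hc ?_
    obtain ⟨j, hj⟩ := hc.elim_directed_cover (fun j => interior (K j)) (fun _ => isOpen_interior)
      (fun x hx => mem_iUnion.2 (hKi x (hcΩ hx)))
      (directed_of_isDirected_le fun a b hab => interior_mono (hKm hab))
    intro i
    obtain ⟨D, hD, hfr⟩ := hsj j i
    refine ⟨D, hD, hfr.mono fun n hn => le_trans ?_ hn⟩
    exact lintegral_mono_set (hj.trans interior_subset)
  · refine (measure_mono ?_).trans hvol
    intro x hx
    refine ⟨hAΩ hx, ?_⟩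
    by_contra h
    have h2 : s < G x := hx
    rw [hG, indicator_of_mem (hAΩ hx), max_eq_left ((min_le_left _ _).trans (by linarith))] at h2
    linarith [hs.1]
  · intro x hx
    refine density_one_of_compl hAm.nullMeasurableSet ?_
    have hxΩ := hC hx
    have hev : ∀ᶠ y in 𝓝 x, y ∈ Ω ∧ η x / 2 < η y :=
      (hΩ.eventually_mem hxΩ).and (hηc.continuousAt.eventually_const_lt (half_lt_self (hpos x hxΩ)))
    obtain ⟨r, hr, hball⟩ := Metric.eventually_nhds_iff_ball.1 hev
    refine density_zero_mono (hd x hx (2 / (η x / 2))) hr ?_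
    rintro y ⟨hy1, hy2⟩
    obtain ⟨h1, h2⟩ := hball y hy2
    refine ⟨h1, ?_⟩
    by_contra h3
    rw [not_lt, div_le_iff₀ (half_pos (hpos x hxΩ))] at h3
    apply hy1
    have h4 : 2 ≤ η y * |u y| := by nlinarith [abs_nonneg (u y)]
    change s < G y
    rw [hG, indicator_of_mem h1, min_eq_right (by linarith), max_eq_right zero_le_one]
    exact hs.2

theorem forward (Ω : Set (Euc N)) (hΩ : IsOpen Ω) (C : Set (Euc N)) (hC : C ⊆ Ω)
    (h : GBVPolar C Ω) : ∃ A : ℕ → Set (Euc N),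
        (∀ k, NullMeasurableSet (A k) volume ∧ A k ⊆ Ω ∧ HasLocFinPerimeter (A k) Ω) ∧
        Tendsto (fun k => volume (A k)) atTop (𝓝 0) ∧
        ∀ x ∈ C, ∀ k, HasDensity (A k) x 1 := by
  obtain ⟨u, ⟨hum, hBV⟩, hlim⟩ := h
  set v := hum.mk u with hv
  have hvm : Measurable v := hum.measurable_mk
  have huv : u =ᵐ[volume.restrict Ω] v := hum.ae_eq_mk
  have hDQ : ∀ m : ℝ, 0 < m → DQ (fun x => max (-m) (min (v x) m)) Ω := by
    intro m hm K hK hKΩ i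
    obtain ⟨V, hV, hKV, hVΩ, hVc⟩ := exists_open_btw Ω K hΩ hK hKΩ
    have h1 := (hBV m hm V hV hVc hVΩ).2
    have h2 : variation (fun x => max (-m) (min (v x) m)) V =
        variation (fun x => max (-m) (min (u x) m)) V := by
      unfold variation
      have : ∀ φ : Euc N → Euc N, ∫ x in V, max (-m) (min (v x) m) * diverg φ x =
          ∫ x in V, max (-m) (min (u x) m) * diverg φ x := by
        intro φ
        refine integral_congr_ae ?_
        filter_upwards [ae_restrict_of_ae_restrict_of_subset (subset_closure.trans hVΩ) huv]
          with x hx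
        rw [hx]
      simp only [this]
    refine ⟨_, (h2.trans_lt h1).ne, ?_⟩
    exact dq_of_variation _ (measurable_const.max (hvm.min measurable_const)) m
      (fun x => by rw [abs_clamp _ _ hm]; exact min_le_right _ _) V K hV hK hKV i
  have hd : ∀ x ∈ C, ∀ r : ℝ, HasDensity {y | y ∈ Ω ∧ |v y| < r} x 0 := by
    intro x hx r
    refine density_congr ?_ (density_abs_lt (hlim hx).2 r)
    rw [EventuallyEq, ae_restrict_iff' hΩ.measurableSet] at huv
    filter_upwards [huv] with y hy
    refine propext ?_
    change (y ∈ Ω ∧ |u y| < r) ↔ (y ∈ Ω ∧ |v y| < r)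
    refine and_congr_right fun hyΩ => ?_
    rw [hy hyΩ]
  choose A hAm hAΩ hAP hAv hAd using fun k : ℕ =>
    forward_aux Ω hΩ C hC v hvm hDQ hd ((k:ℝ≥0∞))⁻¹ (by simp)
  refine ⟨A, fun k => ⟨(hAm k).nullMeasurableSet, hAΩ k, hAP k⟩, ?_, fun x hx k => hAd k x hx⟩
  exact tendsto_of_tendsto_of_tendsto_of_le_of_le tendsto_const_nhds
    ENNReal.tendsto_inv_nat_nhds_zero (fun _ => zero_le) hAv
/-- `C ⊆ Ω` is `GBV`-polar in the open set `Ω` if and only if there is a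
sequence `{A_k}` of measurable subsets of `Ω` with locally finite perimeter in `Ω` such
that `λ^N(A_k) → 0` and `θ(A_k, x) = 1` for every `x ∈ C` and every `k`. -/
theorem statement7 {N : ℕ} (Ω : Set (Euc N)) (hΩ : IsOpen Ω)
    (C : Set (Euc N)) (hC : C ⊆ Ω) :
    GBVPolar C Ω ↔
      ∃ A : ℕ → Set (Euc N),
        (∀ k, NullMeasurableSet (A k) volume ∧ A k ⊆ Ω ∧ HasLocFinPerimeter (A k) Ω) ∧
        Tendsto (fun k => volume (A k)) atTop (𝓝 0) ∧
        ∀ x ∈ C, ∀ k, HasDensity (A k) x 1 := by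
  constructor
  · exact forward Ω hΩ C hC
  · rintro ⟨A, h1, h2, h3⟩
    exact backward Ω hΩ C hC A (fun k => (h1 k).1) (fun k => (h1 k).2.2) h2 h3
end
end
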